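/- arXiv:2003.01423 — 2 statements merged into one kernel-verified Lean document; each statement's English description precedes it below -/
import Mathlib

section
/- Let B = (B_t)_{t≥0} be a fractional Brownian motion of Hurst index H ∈ (0,1) and fix x ∈ ℝ. Then ℙ(Dim_H L_x = 1 − H) = 1, where L_x = { t ≥ 0 : B_t = x }. -/
open MeasureTheory ProbabilityTheory Set
open scoped ENNReal NNReal

noncomputable section

/-- The `n`-th dyadic block `[2^n, 2^(n+1))`, `n : ℕ`.  In the paper's numbering this is the
block `S_{n+1} = [2^{(n+1)-1}, 2^{n+1})`.  (The paper's blocks `S_{-1} = [0,1/2)` and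
`S_0 = [1/2,1)` are degenerate: they contain no interval with distinct integer endpoints,
and dropping finitely many blocks does not change the macroscopic Hausdorff dimension.) -/
def Sblock (n : ℕ) : Set ℝ := Set.Ico ((2 : ℝ) ^ n) ((2 : ℝ) ^ (n + 1))

/-- `c` is a proper cover of `E` restricted to the block `[2^n, 2^(n+1))`: a finite family of
nontrivial intervals `[p.1, p.2]` with integer endpoints `p.1 < p.2`, contained in the block,
whose union covers `E ∩ Sblock n`. -/
def IsProperCover (n : ℕ) (E : Set ℝ) (c : Finset (ℕ × ℕ)) : Prop :=
  (∀ p ∈ c, p.1 < p.2 ∧ (2 : ℝ) ^ n ≤ (p.1 : ℝ) ∧ (p.2 : ℝ) ≤ (2 : ℝ) ^ (n + 1)) ∧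
    E ∩ Sblock n ⊆ ⋃ p ∈ c, Set.Icc (p.1 : ℝ) (p.2 : ℝ)

/-- `ν_ρ^n(E) = inf { Σ_i (diam I_i / 2^(n+1))^ρ }` over proper covers of `E` restricted to
the block `[2^n, 2^(n+1))`.  (The normalizing factor `2^(n+1)` is the right endpoint of the
block, as in the paper.) -/
def nu (ρ : ℝ) (n : ℕ) (E : Set ℝ) : ℝ≥0∞ :=
  ⨅ (c : Finset (ℕ × ℕ)) (_ : IsProperCover n E c),
    ∑ p ∈ c, ENNReal.ofReal ((((p.2 : ℝ) - (p.1 : ℝ)) / 2 ^ (n + 1)) ^ ρ)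

/-- `ν̃_{ρ,ξ}^n(E)`, the variant of `ν_ρ^n(E)` with the extra logarithmic factor
`|log₂ (diam I_i / 2^(n+1))|^ξ` on each covering interval. -/
def nutilde (ρ ξ : ℝ) (n : ℕ) (E : Set ℝ) : ℝ≥0∞ :=
  ⨅ (c : Finset (ℕ × ℕ)) (_ : IsProperCover n E c),
    ∑ p ∈ c, ENNReal.ofReal ((((p.2 : ℝ) - (p.1 : ℝ)) / 2 ^ (n + 1)) ^ ρ *
      |Real.logb 2 (((p.2 : ℝ) - (p.1 : ℝ)) / 2 ^ (n + 1))| ^ ξ)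

/-- The macroscopic Hausdorff dimension
`Dim_H E = inf { ρ > 0 : Σ_n ν_ρ^n(E) < ∞ }`. -/
def macroDim (E : Set ℝ) : ℝ :=
  sInf {ρ : ℝ | 0 < ρ ∧ (∑' n : ℕ, nu ρ n E) ≠ ∞}

/-- `B` is a fractional Brownian motion of Hurst index `H` under the probability measure `P`:
a (jointly in finite-dimensional distributions) centered Gaussian process on `[0,∞)` with
continuous sample paths and covariance `E(B_s B_t) = (s^{2H} + t^{2H} - |s-t|^{2H})/2`. -/
structure IsFractionalBrownianMotion {Ω : Type*} [MeasurableSpace Ω]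
    (P : Measure Ω) (H : ℝ) (B : ℝ → Ω → ℝ) : Prop where
  measurable : ∀ t : ℝ, Measurable (B t)
  continuous : ∀ ω : Ω, ContinuousOn (fun t => B t ω) (Set.Ici 0)
  gaussian : ∀ (m : ℕ) (t : Fin m → ℝ) (c : Fin m → ℝ), (∀ i, 0 ≤ t i) →
    ∃ v : ℝ≥0, P.map (fun ω => ∑ i, c i * B (t i) ω) = gaussianReal 0 v
  covariance : ∀ s t : ℝ, 0 ≤ s → 0 ≤ t →
    ∫ ω, B s ω * B t ω ∂P = (s ^ (2 * H) + t ^ (2 * H) - |s - t| ^ (2 * H)) / 2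

/-- `L` is a local time for the process `B` under `P`: for each `t ≥ 0`, almost surely
`x ↦ L t x ω` is a density of the occupation measure `A ↦ Leb{s ∈ [0,t] : B_s ∈ A}`. -/
structure IsLocalTime {Ω : Type*} [MeasurableSpace Ω] (P : Measure Ω)
    (B : ℝ → Ω → ℝ) (L : ℝ → ℝ → Ω → ℝ) : Prop where
  measurable : ∀ t x : ℝ, Measurable (fun ω => L t x ω)
  nonneg : ∀ t x ω, 0 ≤ L t x ω
  density : ∀ t : ℝ, 0 ≤ t → ∀ᵐ ω ∂P, ∀ A : Set ℝ, MeasurableSet A →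
    volume {s : ℝ | s ∈ Set.Icc 0 t ∧ B s ω ∈ A} = ENNReal.ofReal (∫ x in A, L t x ω)

/-- The level set `L_x = {t ≥ 0 : B_t = x}` of the sample path `B · ω`. -/
def levelSet {Ω : Type*} (B : ℝ → Ω → ℝ) (x : ℝ) (ω : Ω) : Set ℝ :=
  {t : ℝ | 0 ≤ t ∧ B t ω = x}

/-- `Z_n^x = L^x(S_n) / 2^{n(1-H)} = (L^x_{2^n} - L^x_{2^{n-1}}) / 2^{n(1-H)}`, `n : ℕ`. -/
def Z {Ω : Type*} (H : ℝ) (L : ℝ → ℝ → Ω → ℝ) (n : ℕ) (x : ℝ) (ω : Ω) : ℝ :=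
  (L ((2 : ℝ) ^ n) x ω - L ((2 : ℝ) ^ n / 2) x ω) / (2 : ℝ) ^ ((n : ℝ) * (1 - H))

/-- `Z̃_n^a = inf_{x ∈ [-a,a]} Z_n^x`. -/
def Ztilde {Ω : Type*} (H : ℝ) (L : ℝ → ℝ → Ω → ℝ) (n : ℕ) (a : ℝ) (ω : Ω) : ℝ :=
  ⨅ x : Set.Icc (-a) a, Z H L n (x : ℝ) ω

/-- `F_∞^x = Σ_{n ≥ -1} Z_n^x ∈ [0,∞]`; the `n = -1` term is
`L^x(S_{-1}) / 2^{-(1-H)} = (L^x_{1/2} - L^x_0) · 2^{1-H}`. -/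
def Finf {Ω : Type*} (H : ℝ) (L : ℝ → ℝ → Ω → ℝ) (x : ℝ) (ω : Ω) : ℝ≥0∞ :=
  ENNReal.ofReal ((L (1 / 2) x ω - L 0 x ω) * (2 : ℝ) ^ (1 - H)) +
    ∑' n : ℕ, ENNReal.ofReal (Z H L n x ω)

/-- `F̃_∞^b = Σ_{n ≥ 1} Z̃_n^b ∈ [0,∞]`. -/
def Ftilde {Ω : Type*} (H : ℝ) (L : ℝ → ℝ → Ω → ℝ) (b : ℝ) (ω : Ω) : ℝ≥0∞ :=
  ∑' n : ℕ, ENNReal.ofReal (Ztilde H L (n + 1) b ω)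

lemma gaussianReal_Icc_le {v : ℝ≥0} (hv : v ≠ 0) (m x r : ℝ) :
    gaussianReal m v (Icc (x - r) (x + r)) ≤ ENNReal.ofReal (2 * r / √(2 * Real.pi * v)) := by
  rw [gaussianReal_apply m hv]
  calc ∫⁻ y in Icc (x - r) (x + r), gaussianPDF m v y
      ≤ ∫⁻ y in Icc (x - r) (x + r), ENNReal.ofReal (√(2 * Real.pi * v))⁻¹ := by
        refine lintegral_mono fun y => ENNReal.ofReal_le_ofReal ?_
        rw [gaussianPDFReal]
        refine mul_le_of_le_one_right (by positivity) (Real.exp_le_one_iff.2 ?_)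
        exact div_nonpos_of_nonpos_of_nonneg (neg_nonpos.2 (sq_nonneg _)) (by positivity)
    _ = ENNReal.ofReal (2 * r / √(2 * Real.pi * v)) := by
        rw [setLIntegral_const, Real.volume_Icc, ← ENNReal.ofReal_mul (by positivity)]
        congr 1
        ring

lemma le_gaussianReal_Icc {v : ℝ≥0} (hv : v ≠ 0) (x r : ℝ) :
    ENNReal.ofReal (2 * r / √(2 * Real.pi * v) * Real.exp (-(|x| + r) ^ 2 / (2 * v))) ≤
      gaussianReal 0 v (Icc (x - r) (x + r)) := by
  rw [gaussianReal_apply 0 hv]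
  calc ENNReal.ofReal (2 * r / √(2 * Real.pi * v) * Real.exp (-(|x| + r) ^ 2 / (2 * v)))
      = ∫⁻ y in Icc (x - r) (x + r), ENNReal.ofReal
          ((√(2 * Real.pi * v))⁻¹ * Real.exp (-(|x| + r) ^ 2 / (2 * v))) := by
        rw [setLIntegral_const, Real.volume_Icc, ← ENNReal.ofReal_mul (by positivity)]
        congr 1
        ring
    _ ≤ ∫⁻ y in Icc (x - r) (x + r), gaussianPDF 0 v y := by
        refine setLIntegral_mono' measurableSet_Icc fun y hy => ENNReal.ofReal_le_ofReal ?_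
        rw [gaussianPDFReal, sub_zero]
        have h : |y| ≤ |x| + r := by
          obtain ⟨h1, h2⟩ := hy
          exact abs_le.2 ⟨by linarith [neg_abs_le x], by linarith [le_abs_self x]⟩
        have h2 : y ^ 2 ≤ (|x| + r) ^ 2 := by
          rw [← sq_abs y]; exact pow_le_pow_left₀ (abs_nonneg _) h 2
        gcongr

/-- The covariance function of fractional Brownian motion. -/
def fbmCov (H s t : ℝ) : ℝ := (s ^ (2 * H) + t ^ (2 * H) - |s - t| ^ (2 * H)) / 2

lemma fbmCov_self {H : ℝ} (hH : 0 < H) (t : ℝ) : fbmCov H t t = t ^ (2 * H) := by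
  rw [fbmCov, sub_self, abs_zero, Real.zero_rpow (by positivity)]
  ring

namespace IsFractionalBrownianMotion

variable {Ω : Type*} [MeasurableSpace Ω] {P : Measure Ω} {H : ℝ} {B : ℝ → Ω → ℝ}

lemma memLp_two (hB : IsFractionalBrownianMotion P H B) {t : ℝ} (ht : 0 ≤ t) :
    MemLp (B t) 2 P := by
  obtain ⟨v, hv⟩ := hB.gaussian 1 (fun _ => t) (fun _ => 1) (fun _ => ht)
  simp only [Finset.univ_unique, Finset.sum_singleton, one_mul] at hv
  have h := memLp_id_gaussianReal' (μ := 0) (v := v) 2 (by simp)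
  rw [← hv] at h
  exact h.comp_of_map (hB.measurable t).aemeasurable

lemma map_lincomb [IsProbabilityMeasure P] (hB : IsFractionalBrownianMotion P H B)
    (hH : 0 < H) {s t : ℝ} (hs : 0 ≤ s) (ht : 0 ≤ t) (a b : ℝ) :
    P.map (fun ω => a * B s ω + b * B t ω) = gaussianReal 0
      (a ^ 2 * s ^ (2 * H) + 2 * a * b * fbmCov H s t + b ^ 2 * t ^ (2 * H)).toNNReal := by
  obtain ⟨v, hv⟩ := hB.gaussian 2 ![s, t] ![a, b] (by simp [Fin.forall_fin_two, hs, ht])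
  simp only [Fin.sum_univ_two, Matrix.cons_val_zero, Matrix.cons_val_one] at hv
  have hm : Measurable (fun ω => a * B s ω + b * B t ω) :=
    ((hB.measurable s).const_mul a).add ((hB.measurable t).const_mul b)
  have hvar : ∫ ω, (a * B s ω + b * B t ω) ^ 2 ∂P = v := by
    have h1 : Var[id; gaussianReal 0 v] = ∫ y, y ^ 2 ∂(gaussianReal 0 v) := by
      rw [variance_of_integral_eq_zero aemeasurable_id (by simp)]
      rfl
    rw [variance_id_gaussianReal] at h1
    rw [h1, ← hv, integral_map hm.aemeasurable (by fun_prop)]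
  have hexp : ∫ ω, (a * B s ω + b * B t ω) ^ 2 ∂P =
      a ^ 2 * s ^ (2 * H) + 2 * a * b * fbmCov H s t + b ^ 2 * t ^ (2 * H) := by
    have hss := (hB.memLp_two hs).integrable_mul (hB.memLp_two hs)
    have hst := (hB.memLp_two hs).integrable_mul (hB.memLp_two ht)
    have htt := (hB.memLp_two ht).integrable_mul (hB.memLp_two ht)
    have : ∀ ω, (a * B s ω + b * B t ω) ^ 2 = a ^ 2 * (B s ω * B s ω) +
        2 * a * b * (B s ω * B t ω) + b ^ 2 * (B t ω * B t ω) := fun ω => by ring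
    simp_rw [this]
    rw [integral_add, integral_add, integral_const_mul, integral_const_mul, integral_const_mul,
      hB.covariance s s hs hs, hB.covariance s t hs ht, hB.covariance t t ht ht]
    · change a ^ 2 * fbmCov H s s + 2 * a * b * fbmCov H s t + b ^ 2 * fbmCov H t t = _
      rw [fbmCov_self hH, fbmCov_self hH]
    · exact hss.const_mul _
    · exact hst.const_mul _
    · exact (hss.const_mul _).add (hst.const_mul _)
    · exact htt.const_mul _
  rw [hv, ← hexp, hvar, Real.toNNReal_coe]

lemma map_eq [IsProbabilityMeasure P] (hB : IsFractionalBrownianMotion P H B)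
    (hH : 0 < H) {t : ℝ} (ht : 0 ≤ t) :
    P.map (B t) = gaussianReal 0 (t ^ (2 * H)).toNNReal := by
  simpa using hB.map_lincomb hH ht ht 0 1

lemma map_sub_eq [IsProbabilityMeasure P] (hB : IsFractionalBrownianMotion P H B)
    (hH : 0 < H) {s t : ℝ} (hs : 0 ≤ s) (ht : 0 ≤ t) :
    P.map (fun ω => B t ω - B s ω) = gaussianReal 0 (|s - t| ^ (2 * H)).toNNReal := by
  have h := hB.map_lincomb hH hs ht (-1) 1
  simp only [neg_mul, one_mul, neg_add_eq_sub] at h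
  rw [h, fbmCov]
  congr 2
  ring

lemma hasGaussianLaw_pair [IsProbabilityMeasure P] (hB : IsFractionalBrownianMotion P H B)
    {s t : ℝ} (hs : 0 ≤ s) (ht : 0 ≤ t) :
    HasGaussianLaw (fun ω => (B s ω, B t ω)) P := by
  refine ⟨isGaussian_of_map_eq_gaussianReal fun L => ⟨0, ?_⟩⟩
  obtain ⟨v, hv⟩ := hB.gaussian 2 ![s, t] ![L (1, 0), L (0, 1)]
    (by simp [Fin.forall_fin_two, hs, ht])
  refine ⟨v, ?_⟩
  rw [Measure.map_map (by fun_prop) ((hB.measurable s).prodMk (hB.measurable t)), ← hv]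
  congr 1
  ext ω
  simp only [Function.comp_apply, Fin.sum_univ_two, Matrix.cons_val_zero, Matrix.cons_val_one]
  have : ((B s ω, B t ω) : ℝ × ℝ) = B s ω • ((1 : ℝ), (0 : ℝ)) + B t ω • ((0 : ℝ), (1 : ℝ)) := by
    simp
  rw [this, map_add, map_smul, map_smul, smul_eq_mul, smul_eq_mul]
  ring

lemma indepFun_residual [IsProbabilityMeasure P] (hB : IsFractionalBrownianMotion P H B)
    (hH : 0 < H) {s t : ℝ} (hs : 0 < s) (ht : 0 ≤ t) :
    IndepFun (B s) (fun ω => -(fbmCov H s t / s ^ (2 * H)) * B s ω + 1 * B t ω) P := by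
  set a := -(fbmCov H s t / s ^ (2 * H)) with ha
  have hpair : HasGaussianLaw (fun ω => (B s ω, a * B s ω + 1 * B t ω)) P := by
    have h := (hB.hasGaussianLaw_pair hs.le ht).map_fun
      ((ContinuousLinearMap.fst ℝ ℝ ℝ).prod
        (a • ContinuousLinearMap.fst ℝ ℝ ℝ + (1 : ℝ) • ContinuousLinearMap.snd ℝ ℝ ℝ))
    simpa using h
  refine hpair.indepFun_of_covariance_eq_zero ?_
  have hmean : ∀ u, 0 ≤ u → ∫ ω, B u ω ∂P = 0 := fun u hu => by
    have h : ∫ y, y ∂(P.map (B u)) = 0 := by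
      rw [hB.map_eq hH hu]; exact integral_id_gaussianReal
    rwa [integral_map (hB.measurable u).aemeasurable (by fun_prop)] at h
  have hcov : ∀ u, 0 ≤ u → cov[B s, B u; P] = fbmCov H s u := fun u hu => by
    rw [covariance_eq_sub (hB.memLp_two hs.le) (hB.memLp_two hu), hmean u hu, mul_zero, sub_zero]
    exact hB.covariance s u hs.le hu
  have h1 := (hB.memLp_two hs.le).const_mul a
  have h2 := (hB.memLp_two ht).const_mul 1
  have h3 := covariance_add_right (hB.memLp_two hs.le) h1 h2
  have h4 : s ^ (2 * H) ≠ 0 := (Real.rpow_pos_of_pos hs _).ne'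
  change cov[B s, (fun ω => a * B s ω) + (fun ω => 1 * B t ω); P] = 0
  rw [h3, covariance_const_mul_right, covariance_const_mul_right, hcov s hs.le, hcov t ht,
    fbmCov_self hH, ha]
  field_simp
  ring

lemma measure_near_le [IsProbabilityMeasure P] (hB : IsFractionalBrownianMotion P H B)
    (hH : 0 < H) {t : ℝ} (ht : 0 < t) (x r : ℝ) :
    P {ω | |B t ω - x| ≤ r} ≤ ENNReal.ofReal (2 * r / √(2 * Real.pi * t ^ (2 * H))) := by
  have hpos := Real.rpow_pos_of_pos ht (2 * H)
  have h := gaussianReal_Icc_le (v := (t ^ (2 * H)).toNNReal) (by simpa using hpos) 0 x r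
  rw [← hB.map_eq hH ht.le, Measure.map_apply (hB.measurable t) measurableSet_Icc,
    Real.coe_toNNReal _ hpos.le] at h
  refine le_trans (measure_mono fun ω hω => ?_) h
  have := abs_le.1 (mem_ofPred.1 hω)
  exact ⟨by linarith, by linarith⟩

lemma le_measure_near [IsProbabilityMeasure P] (hB : IsFractionalBrownianMotion P H B)
    (hH : 0 < H) {t : ℝ} (ht : 0 < t) (x r : ℝ) :
    ENNReal.ofReal (2 * r / √(2 * Real.pi * t ^ (2 * H)) *
      Real.exp (-(|x| + r) ^ 2 / (2 * t ^ (2 * H)))) ≤ P {ω | |B t ω - x| ≤ r} := by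
  have hpos := Real.rpow_pos_of_pos ht (2 * H)
  have h := le_gaussianReal_Icc (v := (t ^ (2 * H)).toNNReal) (by simpa using hpos) x r
  rw [← hB.map_eq hH ht.le, Measure.map_apply (hB.measurable t) measurableSet_Icc,
    Real.coe_toNNReal _ hpos.le] at h
  refine h.trans (measure_mono fun ω hω => ?_)
  obtain ⟨h1, h2⟩ := hω
  exact (abs_le.2 ⟨by linarith, by linarith⟩ : |B t ω - x| ≤ r)

lemma measure_near_inter_le [IsProbabilityMeasure P] (hB : IsFractionalBrownianMotion P H B)
    (hH : 0 < H) {s t w : ℝ} (hs : 0 < s) (ht : 0 ≤ t) (hw : 0 < w)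
    (hvar : w ≤ t ^ (2 * H) - fbmCov H s t ^ 2 / s ^ (2 * H)) (x : ℝ) {r : ℝ} (hr : 0 ≤ r) :
    P ({ω | |B s ω - x| ≤ r} ∩ {ω | |B t ω - x| ≤ r}) ≤
      P {ω | |B s ω - x| ≤ r} * ENNReal.ofReal (2 * r / √(2 * Real.pi * w)) := by
  have hsH := Real.rpow_pos_of_pos hs (2 * H)
  set a := fbmCov H s t / s ^ (2 * H) with ha
  set v := t ^ (2 * H) - fbmCov H s t ^ 2 / s ^ (2 * H) with hv
  set R : Ω → ℝ := fun ω => -a * B s ω + 1 * B t ω with hR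
  have hvpos : 0 < v := hw.trans_le hvar
  have hRm : Measurable R :=
    ((hB.measurable s).const_mul _).add ((hB.measurable t).const_mul _)
  have hmapR : P.map R = gaussianReal 0 v.toNNReal := by
    rw [hR, hB.map_lincomb hH hs.le ht (-a) 1]
    congr 2
    rw [ha, hv]
    field_simp
    ring
  have hind := hB.indepFun_residual hH hs ht
  have hprod := (indepFun_iff_map_prod_eq_prod_map_map (hB.measurable s).aemeasurable
    hRm.aemeasurable).1 hind
  set A : Set (ℝ × ℝ) := {p | |p.1 - x| ≤ r} ∩ {p | |a * p.1 + p.2 - x| ≤ r} with hA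
  have hAm : MeasurableSet A :=
    (measurableSet_le (by fun_prop) measurable_const).inter
      (measurableSet_le (by fun_prop) measurable_const)
  have hset : ({ω | |B s ω - x| ≤ r} ∩ {ω | |B t ω - x| ≤ r}) =
      (fun ω => (B s ω, R ω)) ⁻¹' A := by
    ext ω
    simp [hA, hR]
  rw [hset, ← Measure.map_apply ((hB.measurable s).prodMk hRm) hAm, hprod,
    Measure.prod_apply hAm]
  have hCm : MeasurableSet {y : ℝ | |y - x| ≤ r} :=
    (isClosed_le (by fun_prop) continuous_const).measurableSet
  calc ∫⁻ y, (P.map R) (Prod.mk y ⁻¹' A) ∂(P.map (B s))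
      ≤ ∫⁻ y, {y : ℝ | |y - x| ≤ r}.indicator
          (fun _ => ENNReal.ofReal (2 * r / √(2 * Real.pi * w))) y ∂(P.map (B s)) := by
        refine lintegral_mono fun y => ?_
        by_cases hy : y ∈ {y : ℝ | |y - x| ≤ r}
        · rw [indicator_of_mem hy, hmapR]
          refine (measure_mono (t := Icc ((x - a * y) - r) ((x - a * y) + r)) ?_).trans
            ((gaussianReal_Icc_le (by simpa using hvpos) 0 _ r).trans ?_)
          · intro z hz
            have h : |a * y + z - x| ≤ r := hz.2
            have := abs_le.1 h
            exact ⟨by linarith, by linarith⟩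
          · refine ENNReal.ofReal_le_ofReal ?_
            rw [Real.coe_toNNReal _ hvpos.le]
            gcongr
        · rw [indicator_of_notMem hy]
          refine le_of_eq (measure_mono_null (t := ∅) ?_ measure_empty)
          intro z hz
          exact hy hz.1
    _ = P {ω | |B s ω - x| ≤ r} * ENNReal.ofReal (2 * r / √(2 * Real.pi * w)) := by
        rw [lintegral_indicator_const hCm, mul_comm, Measure.map_apply (hB.measurable s) hCm]
        rfl

end IsFractionalBrownianMotion

lemma sqrt_mul_rpow_two_mul {c t H : ℝ} (hc : 0 ≤ c) (ht : 0 ≤ t) :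
    √(c * t ^ (2 * H)) = √c * t ^ H := by
  rw [Real.sqrt_mul hc, mul_comm 2 H, Real.rpow_mul ht, Real.sqrt_eq_rpow (_ ^ _),
    ← Real.rpow_mul (Real.rpow_nonneg ht H)]
  norm_num

lemma rpow_two_mul {t H : ℝ} (ht : 0 ≤ t) : t ^ (2 * H) = (t ^ H) ^ 2 := by
  rw [mul_comm, Real.rpow_mul ht, Real.rpow_two]

/-- Local nondeterminism of fractional Brownian motion at two nearby times. -/
lemma residual_variance_ge {H s t : ℝ} (hH : H ∈ Ioo (0 : ℝ) 1) (hs : 0 < s) (hst : s < t)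
    (hts : t ≤ 2 * s) :
    (1 - H) / 2 * (t - s) ^ (2 * H) ≤ t ^ (2 * H) - fbmCov H s t ^ 2 / s ^ (2 * H) := by
  obtain ⟨hH0, hH1⟩ := hH
  have ht : 0 < t := hs.trans hst
  have hd : 0 < t - s := sub_pos.2 hst
  rw [fbmCov, abs_sub_comm, abs_of_pos hd, rpow_two_mul hs.le, rpow_two_mul ht.le,
    rpow_two_mul hd.le]
  have ha : 0 < s ^ H := Real.rpow_pos_of_pos hs H
  have hdp : 0 < (t - s) ^ H := Real.rpow_pos_of_pos hd H
  have hdb : (t - s) ^ H ≤ t ^ H := Real.rpow_le_rpow hd.le (by linarith) hH0.le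
  have hab : s ^ H ≤ t ^ H := Real.rpow_le_rpow hs.le hst.le hH0.le
  have hsub : t ^ H ≤ s ^ H + H * (t - s) ^ H := by
    have hu : 0 < (t - s) / s := div_pos hd hs
    have hu1 : (t - s) / s ≤ 1 := by rw [div_le_one hs]; linarith
    have h1 : t = s * (1 + (t - s) / s) := by field_simp; ring
    have h2 : (1 + (t - s) / s) ^ H ≤ 1 + H * ((t - s) / s) :=
      rpow_one_add_le_one_add_mul_self (by linarith) hH0.le hH1.le
    have h3 : (t - s) / s ≤ ((t - s) / s) ^ H := by
      simpa using Real.rpow_le_rpow_of_exponent_ge hu hu1 hH1.le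
    have h4 : s ^ H * ((t - s) / s) ^ H = (t - s) ^ H := by
      rw [← Real.mul_rpow hs.le hu.le]; congr 1; field_simp
    calc t ^ H = s ^ H * (1 + (t - s) / s) ^ H := by
          conv_lhs => rw [h1]
          rw [Real.mul_rpow hs.le (by linarith)]
      _ ≤ s ^ H * (1 + H * ((t - s) / s) ^ H) := by gcongr; nlinarith
      _ = s ^ H + H * (t - s) ^ H := by rw [← h4]; ring
  set a := s ^ H
  set b := t ^ H
  set d := (t - s) ^ H
  rw [le_sub_iff_add_le, ← le_sub_iff_add_le', div_le_iff₀ (by positivity)]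
  have key : 2 * (1 - H) * (a ^ 2 * d ^ 2) ≤ (a + b + d) * (a + b - d) * (d + a - b) * (d - a + b) := by
    have e1 : 2 * a ≤ a + b + d := by linarith
    have e2 : a ≤ a + b - d := by linarith
    have e3 : (1 - H) * d ≤ d + a - b := by linarith
    have e4 : d ≤ d - a + b := by linarith
    have hHd : 0 ≤ (1 - H) * d := mul_nonneg (by linarith) hdp.le
    have p1 : 0 ≤ (a + b + d) * (a + b - d) := mul_nonneg (by linarith) (by linarith)
    have p2 : 0 ≤ (a + b + d) * (a + b - d) * (d + a - b) := mul_nonneg p1 (by linarith)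
    calc 2 * (1 - H) * (a ^ 2 * d ^ 2) = (2 * a) * a * ((1 - H) * d) * d := by ring
      _ ≤ _ := by gcongr
  nlinarith [key]

lemma residual_variance_ge_of_far {H s t : ℝ} (hH : H ∈ Ioo (0 : ℝ) 1) (hs : 0 < s)
    (hst : s ≤ t) :
    t ^ (2 * H) * (1 - ((s / t) ^ H / 2 + (s / t) ^ (1 - H)) ^ 2) ≤
      t ^ (2 * H) - fbmCov H s t ^ 2 / s ^ (2 * H) := by
  obtain ⟨hH0, hH1⟩ := hH
  have ht : 0 < t := hs.trans_le hst
  set u := s / t with hu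
  have hu0 : 0 < u := div_pos hs ht
  have hu1 : u ≤ 1 := (div_le_one ht).2 hst
  have hsu : s = t * u := by rw [hu]; field_simp
  have htH : 0 < t ^ (2 * H) := Real.rpow_pos_of_pos ht _
  have huH : 0 < u ^ H := Real.rpow_pos_of_pos hu0 _
  have h1u : 0 ≤ 1 - u := by linarith
  have hpow : (1 - u) ^ (2 * H) ≤ 1 := Real.rpow_le_one h1u (by linarith) (by linarith)
  have hpow2 : 1 - 2 * u ≤ (1 - u) ^ (2 * H) := by
    rcases h1u.eq_or_lt with h | h
    · rw [← h, Real.zero_rpow (by positivity)]; linarith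
    · have := Real.rpow_le_rpow_of_exponent_ge h (by linarith : 1 - u ≤ 1)
        (by linarith : 2 * H ≤ 2)
      rw [Real.rpow_two] at this
      nlinarith [sq_nonneg u]
  have hcov : fbmCov H s t = t ^ (2 * H) * ((u ^ H) ^ 2 + 1 - (1 - u) ^ (2 * H)) / 2 := by
    rw [fbmCov, abs_sub_comm, abs_of_nonneg (by linarith : 0 ≤ t - s),
      show t - s = t * (1 - u) by rw [hsu]; ring, Real.mul_rpow ht.le h1u]
    conv_lhs => rw [hsu]
    rw [Real.mul_rpow ht.le hu0.le, rpow_two_mul hu0.le]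
    ring
  have hsH : s ^ (2 * H) = t ^ (2 * H) * (u ^ H) ^ 2 := by
    rw [hsu, Real.mul_rpow ht.le hu0.le, rpow_two_mul hu0.le]
  have hu' : u ^ (1 - H) * u ^ H = u := by
    rw [← Real.rpow_add hu0]; simp
  rw [hcov, hsH]
  have hle : ((u ^ H) ^ 2 + 1 - (1 - u) ^ (2 * H)) / 2 ≤ (u ^ H / 2 + u ^ (1 - H)) * u ^ H := by
    have : (u ^ H / 2 + u ^ (1 - H)) * u ^ H = (u ^ H) ^ 2 / 2 + u := by
      rw [add_mul, hu']; ring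
    rw [this]; linarith
  have h0 : 0 ≤ ((u ^ H) ^ 2 + 1 - (1 - u) ^ (2 * H)) / 2 := by nlinarith [sq_nonneg (u ^ H)]
  have hsq := pow_le_pow_left₀ h0 hle 2
  have : (t ^ (2 * H) * ((u ^ H) ^ 2 + 1 - (1 - u) ^ (2 * H)) / 2) ^ 2 /
      (t ^ (2 * H) * (u ^ H) ^ 2) =
      t ^ (2 * H) * ((((u ^ H) ^ 2 + 1 - (1 - u) ^ (2 * H)) / 2) ^ 2 / (u ^ H) ^ 2) := by
    field_simp
  rw [this, mul_sub, mul_one]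
  refine sub_le_sub_left (mul_le_mul_of_nonneg_left ?_ htH.le) _
  rw [div_le_iff₀ (by positivity), ← mul_pow]
  exact hsq

lemma exists_residual_variance_ge {H : ℝ} (hH : H ∈ Ioo (0 : ℝ) 1) {η : ℝ} (hη : 0 < η) :
    ∃ T : ℝ, 1 ≤ T ∧ ∀ s t : ℝ, 0 < s → T * s ≤ t →
      t ^ (2 * H) / (1 + η) ^ 2 ≤ t ^ (2 * H) - fbmCov H s t ^ 2 / s ^ (2 * H) := by
  have hlim : Filter.Tendsto (fun u : ℝ => 1 - (u ^ H / 2 + u ^ (1 - H)) ^ 2)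
      (nhds 0) (nhds (1 - ((0 : ℝ) ^ H / 2 + (0 : ℝ) ^ (1 - H)) ^ 2)) := by
    have c1 := (Real.continuous_rpow_const hH.1.le).tendsto (0 : ℝ)
    have c2 := (Real.continuous_rpow_const (q := 1 - H) (by linarith [hH.2])).tendsto (0 : ℝ)
    exact (((c1.div_const 2).add c2).pow 2).const_sub 1
  rw [Real.zero_rpow hH.1.ne', Real.zero_rpow (by linarith [hH.2])] at hlim
  have hlt : 1 / (1 + η) ^ 2 < 1 - ((0 : ℝ) / 2 + 0) ^ 2 := by
    rw [div_lt_iff₀ (by positivity)]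
    nlinarith
  obtain ⟨ε, hε, hball⟩ := Metric.eventually_nhds_iff.1 (hlim.eventually (lt_mem_nhds hlt))
  refine ⟨max 1 (2 / ε), le_max_left _ _, fun s t hs hst => ?_⟩
  have ht1 : s ≤ t := by
    refine le_trans ?_ hst
    exact le_mul_of_one_le_left hs.le (le_max_left _ _)
  have ht : 0 < t := hs.trans_le ht1
  refine le_trans ?_ (residual_variance_ge_of_far hH hs ht1)
  have hu : s / t < ε := by
    rw [div_lt_iff₀ ht]
    have h1 : 2 / ε * s ≤ t := (mul_le_mul_of_nonneg_right (le_max_right _ _) hs.le).trans hst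
    rw [div_mul_eq_mul_div, div_le_iff₀ hε] at h1
    nlinarith
  have := @hball (s / t) (by rw [Real.dist_eq, sub_zero, abs_of_pos (div_pos hs ht)]; exact hu)
  rw [div_eq_mul_one_div]
  exact mul_le_mul_of_nonneg_left this.le (Real.rpow_nonneg ht.le _)

namespace IsFractionalBrownianMotion

variable {Ω : Type*} [MeasurableSpace Ω] {P : Measure Ω} {H : ℝ} {B : ℝ → Ω → ℝ}

lemma measure_near_le_rpow [IsProbabilityMeasure P] (hB : IsFractionalBrownianMotion P H B)
    (hH : 0 < H) {t : ℝ} (ht : 0 < t) (x r : ℝ) :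
    P {ω | |B t ω - x| ≤ r} ≤ ENNReal.ofReal (2 * r * (√(2 * Real.pi))⁻¹ * t ^ (-H)) := by
  refine (hB.measure_near_le hH ht x r).trans_eq ?_
  rw [sqrt_mul_rpow_two_mul (by positivity) ht.le, Real.rpow_neg ht.le]
  congr 1
  field_simp

lemma exists_le_measure_near [IsProbabilityMeasure P] (hB : IsFractionalBrownianMotion P H B)
    (hH : 0 < H) (x : ℝ) {η : ℝ} (hη : 0 < η) :
    ∃ t₀ : ℝ, 1 ≤ t₀ ∧ ∀ t r : ℝ, t₀ ≤ t → 0 ≤ r → r ≤ 1 →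
      ENNReal.ofReal (2 * r * (√(2 * Real.pi))⁻¹ * t ^ (-H) * (1 - η)) ≤
        P {ω | |B t ω - x| ≤ r} := by
  have hlim : Filter.Tendsto (fun t : ℝ => Real.exp (-(|x| + 1) ^ 2 / (2 * t ^ (2 * H))))
      Filter.atTop (nhds 1) := by
    rw [← Real.exp_zero]
    refine (Real.continuous_exp.tendsto 0).comp ?_
    exact ((tendsto_rpow_atTop (by positivity)).const_mul_atTop two_pos).const_div_atTop _
  obtain ⟨t₀, ht₀⟩ := Filter.eventually_atTop.1
    (hlim.eventually (lt_mem_nhds (by linarith : 1 - η < 1)))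
  refine ⟨max 1 t₀, le_max_left _ _, fun t r ht hr hr1 => ?_⟩
  have htpos : 0 < t := one_pos.trans_le ((le_max_left _ _).trans ht)
  refine le_trans (ENNReal.ofReal_le_ofReal ?_) (hB.le_measure_near hH htpos x r)
  have h1 := (ht₀ t ((le_max_right _ _).trans ht)).le
  have h2 : Real.exp (-(|x| + 1) ^ 2 / (2 * t ^ (2 * H))) ≤
      Real.exp (-(|x| + r) ^ 2 / (2 * t ^ (2 * H))) := by
    have := Real.rpow_pos_of_pos htpos (2 * H)
    gcongr
  have h3 : 2 * r * (√(2 * Real.pi))⁻¹ * t ^ (-H) = 2 * r / √(2 * Real.pi * t ^ (2 * H)) := by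
    rw [sqrt_mul_rpow_two_mul (by positivity) htpos.le, Real.rpow_neg htpos.le]
    field_simp
  rw [h3]
  gcongr
  exact h1.trans h2

lemma measure_near_inter_le_of_lt [IsProbabilityMeasure P]
    (hB : IsFractionalBrownianMotion P H B) (hH : H ∈ Ioo (0 : ℝ) 1) {a s t : ℝ} (ha : 0 < a)
    (hs : a ≤ s) (hst : s < t) (ht : t ≤ 2 * a) (x : ℝ) {r : ℝ} (hr : 0 ≤ r) :
    P ({ω | |B s ω - x| ≤ r} ∩ {ω | |B t ω - x| ≤ r}) ≤
      ENNReal.ofReal ((2 * r) ^ 2 *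
        ((2 * Real.pi * √((1 - H) / 2))⁻¹ * a ^ (-H) * (t - s) ^ (-H))) := by
  have hspos : 0 < s := ha.trans_le hs
  have hd : 0 < t - s := sub_pos.2 hst
  have hH1 : 0 < (1 - H) / 2 := by linarith [hH.2]
  have hdH := Real.rpow_pos_of_pos hd (2 * H)
  refine (hB.measure_near_inter_le hH.1 hspos (hspos.trans hst).le (mul_pos hH1 hdH)
    (residual_variance_ge hH hspos hst (by linarith)) x hr).trans ?_
  refine (mul_le_mul_left (hB.measure_near_le_rpow hH.1 hspos x r) _).trans ?_
  have hsa : s ^ (-H) ≤ a ^ (-H) := Real.rpow_le_rpow_of_nonpos ha hs (by linarith [hH.1])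
  have hs0 := Real.rpow_nonneg hspos.le (-H)
  rw [← ENNReal.ofReal_mul (by positivity)]
  refine ENNReal.ofReal_le_ofReal ?_
  rw [← mul_assoc (2 * Real.pi), sqrt_mul_rpow_two_mul (by positivity) hd.le,
    Real.rpow_neg hd.le, Real.sqrt_mul (by positivity) ((1 - H) / 2)]
  have hpi : 2 * Real.pi = √(2 * Real.pi) * √(2 * Real.pi) :=
    (Real.mul_self_sqrt (by positivity)).symm
  have hdp := Real.rpow_pos_of_pos hd H
  calc 2 * r * (√(2 * Real.pi))⁻¹ * s ^ (-H) *
        (2 * r / (√(2 * Real.pi) * √((1 - H) / 2) * (t - s) ^ H))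
      ≤ 2 * r * (√(2 * Real.pi))⁻¹ * a ^ (-H) *
        (2 * r / (√(2 * Real.pi) * √((1 - H) / 2) * (t - s) ^ H)) := by gcongr
    _ = (2 * r) ^ 2 * (((√(2 * Real.pi) * √(2 * Real.pi)) * √((1 - H) / 2))⁻¹ * a ^ (-H) *
        ((t - s) ^ H)⁻¹) := by
        field_simp
    _ = _ := by rw [← hpi]

lemma measure_near_inter_le_of_ne [IsProbabilityMeasure P]
    (hB : IsFractionalBrownianMotion P H B) (hH : H ∈ Ioo (0 : ℝ) 1) {a s t : ℝ} (ha : 0 < a)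
    (hs : s ∈ Icc a (2 * a)) (ht : t ∈ Icc a (2 * a)) (hst : s ≠ t) (x : ℝ) {r : ℝ}
    (hr : 0 ≤ r) :
    P ({ω | |B s ω - x| ≤ r} ∩ {ω | |B t ω - x| ≤ r}) ≤
      ENNReal.ofReal ((2 * r) ^ 2 *
        ((2 * Real.pi * √((1 - H) / 2))⁻¹ * a ^ (-H) * |t - s| ^ (-H))) := by
  rcases hst.lt_or_gt with h | h
  · rw [abs_of_pos (sub_pos.2 h)]
    exact hB.measure_near_inter_le_of_lt hH ha hs.1 h ht.2 x hr
  · rw [inter_comm, abs_sub_comm, abs_of_pos (sub_pos.2 h)]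
    exact hB.measure_near_inter_le_of_lt hH ha ht.1 h hs.2 x hr

/-- Asymptotic decorrelation of the visits to `x` at well separated times. -/
lemma exists_measure_near_inter_le [IsProbabilityMeasure P]
    (hB : IsFractionalBrownianMotion P H B) (hH : H ∈ Ioo (0 : ℝ) 1) {η : ℝ} (hη : 0 < η) :
    ∃ T : ℝ, 1 ≤ T ∧ ∀ s t x r : ℝ, 0 < s → T * s ≤ t → 0 ≤ r →
      P ({ω | |B s ω - x| ≤ r} ∩ {ω | |B t ω - x| ≤ r}) ≤
        ENNReal.ofReal (2 * r * (√(2 * Real.pi))⁻¹ * s ^ (-H)) *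
          ENNReal.ofReal (2 * r * (√(2 * Real.pi))⁻¹ * t ^ (-H) * (1 + η)) := by
  obtain ⟨T, hT, h⟩ := exists_residual_variance_ge hH hη
  refine ⟨T, hT, fun s t x r hs hst hr => ?_⟩
  have ht : 0 < t := hs.trans_le (le_trans (le_mul_of_one_le_left hs.le hT) hst)
  have htH := Real.rpow_pos_of_pos ht (2 * H)
  have htH' := Real.rpow_pos_of_pos ht H
  refine (hB.measure_near_inter_le hH.1 hs ht.le (by positivity) (h s t hs hst) x hr).trans ?_
  refine mul_le_mul' (hB.measure_near_le_rpow hH.1 hs x r) (ENNReal.ofReal_le_ofReal ?_)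
  rw [← mul_div_assoc, Real.sqrt_div (by positivity), Real.sqrt_sq (by positivity),
    sqrt_mul_rpow_two_mul (by positivity) ht.le, Real.rpow_neg ht.le]
  refine le_of_eq ?_
  field_simp

end IsFractionalBrownianMotion

/-- The Riesz kernel `|t - s| ^ (-ρ)`, infinite on the diagonal if `ρ > 0`. -/
def rieszKernel (ρ t s : ℝ) : ℝ≥0∞ := ENNReal.ofReal |t - s| ^ (-ρ)

lemma measurable_rieszKernel (ρ : ℝ) : Measurable (Function.uncurry (rieszKernel ρ)) := by
  unfold rieszKernel Function.uncurry
  fun_prop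

/-- The Riesz energy of Lebesgue measure restricted to `A`. -/
def rieszEnergy (ρ : ℝ) (A : Set ℝ) : ℝ≥0∞ := ∫⁻ t in A, ∫⁻ s in A, rieszKernel ρ t s

lemma rieszEnergy_inter_add_diff_le (ρ : ℝ) (A : Set ℝ) {I : Set ℝ} (hI : MeasurableSet I) :
    rieszEnergy ρ (A ∩ I) + rieszEnergy ρ (A \ I) ≤ rieszEnergy ρ A := by
  unfold rieszEnergy
  rw [← lintegral_inter_add_sdiff (fun t => ∫⁻ s in A, rieszKernel ρ t s) A hI]
  exact add_le_add
    (lintegral_mono fun t => lintegral_mono_set inter_subset_left)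
    (lintegral_mono fun t => lintegral_mono_set sdiff_subset)

lemma le_rieszEnergy {ρ p q : ℝ} (hρ : 0 ≤ ρ) {A : Set ℝ} (hA : MeasurableSet A)
    (hAI : A ⊆ Icc p q) :
    ENNReal.ofReal (q - p) ^ (-ρ) * volume A ^ 2 ≤ rieszEnergy ρ A := by
  calc ENNReal.ofReal (q - p) ^ (-ρ) * volume A ^ 2
      = ∫⁻ t in A, ∫⁻ s in A, ENNReal.ofReal (q - p) ^ (-ρ) := by
        rw [setLIntegral_const, setLIntegral_const]; ring
    _ ≤ rieszEnergy ρ A := by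
        refine setLIntegral_mono' hA fun t ht => setLIntegral_mono' hA fun s hs => ?_
        obtain ⟨t1, t2⟩ := hAI ht
        obtain ⟨s1, s2⟩ := hAI hs
        rw [rieszKernel, ENNReal.rpow_neg, ENNReal.rpow_neg]
        refine ENNReal.inv_le_inv.2 (ENNReal.rpow_le_rpow (ENNReal.ofReal_le_ofReal ?_) hρ)
        exact abs_le.2 ⟨by linarith, by linarith⟩

lemma two_mul_volume_le_of_subset_Icc {ρ p q l z K : ℝ} (hρ : 0 ≤ ρ) (hpq : p < q) (hl : 0 < l)
    (hz : 0 ≤ z) (hK : 0 < K) {A : Set ℝ} (hA : MeasurableSet A) (hAI : A ⊆ Icc p q) :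
    2 * (ENNReal.ofReal z * volume A) ≤ ENNReal.ofReal K * ENNReal.ofReal (((q - p) / l) ^ ρ) +
      ENNReal.ofReal K⁻¹ * (ENNReal.ofReal (z ^ 2 * l ^ ρ) * rieszEnergy ρ A) := by
  have hd : 0 < q - p := sub_pos.2 hpq
  have hfin : volume A ≠ ∞ := ((measure_mono hAI).trans_lt measure_Icc_lt_top).ne
  have hE := le_rieszEnergy hρ hA hAI
  refine le_trans ?_ (add_le_add_right (mul_le_mul_right (mul_le_mul_right hE _) _) _)
  rw [← ENNReal.ofReal_toReal hfin]
  set v := (volume A).toReal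
  have hv : 0 ≤ v := ENNReal.toReal_nonneg
  have hy : 0 < ((q - p) / l) ^ ρ := Real.rpow_pos_of_pos (div_pos hd hl) _
  have hlρ := Real.rpow_pos_of_pos hl ρ
  have hdρ := Real.rpow_pos_of_pos hd ρ
  rw [ENNReal.ofReal_rpow_of_pos hd, ← ENNReal.ofReal_pow hv, ← ENNReal.ofReal_mul (by positivity),
    ← ENNReal.ofReal_mul (by positivity), ← ENNReal.ofReal_mul (by positivity),
    ← ENNReal.ofReal_mul (by positivity), ← ENNReal.ofReal_mul (by positivity),
    ← ENNReal.ofReal_add (by positivity) (by positivity),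
    show (2 : ℝ≥0∞) = ENNReal.ofReal 2 by simp, ← ENNReal.ofReal_mul (by positivity)]
  refine ENNReal.ofReal_le_ofReal ?_
  have hinv : z ^ 2 * l ^ ρ * ((q - p) ^ (-ρ) * v ^ 2) = (z * v) ^ 2 / ((q - p) / l) ^ ρ := by
    rw [Real.div_rpow hd.le hl.le, Real.rpow_neg hd.le]
    field_simp
  rw [hinv]
  set y := ((q - p) / l) ^ ρ
  have hKy : 0 < K * y := mul_pos hK hy
  have : K⁻¹ * ((z * v) ^ 2 / y) = (z * v) ^ 2 / (K * y) := by field_simp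
  rw [this, ← sub_nonneg]
  have : K * y + (z * v) ^ 2 / (K * y) - 2 * (z * v) = (K * y - z * v) ^ 2 / (K * y) := by
    field_simp; ring
  rw [this]
  positivity

/-- A quantitative form of the capacity lower bound for Hausdorff contents. -/
lemma two_mul_volume_le_of_subset_biUnion {ρ l z K : ℝ} (hρ : 0 ≤ ρ) (hl : 0 < l)
    (hz : 0 ≤ z) (hK : 0 < K) (c : Finset (ℕ × ℕ)) (hc : ∀ p ∈ c, p.1 < p.2) {A : Set ℝ}
    (hA : MeasurableSet A) (hAc : A ⊆ ⋃ p ∈ c, Icc (p.1 : ℝ) (p.2 : ℝ)) :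
    2 * (ENNReal.ofReal z * volume A) ≤
      ENNReal.ofReal K * ∑ p ∈ c, ENNReal.ofReal ((((p.2 : ℝ) - (p.1 : ℝ)) / l) ^ ρ) +
      ENNReal.ofReal K⁻¹ * (ENNReal.ofReal (z ^ 2 * l ^ ρ) * rieszEnergy ρ A) := by
  classical
  induction c using Finset.induction_on generalizing A with
  | empty =>
    have : A = ∅ := by simpa using hAc
    simp [this]
  | insert p c hp ih =>
    set I := Icc (p.1 : ℝ) (p.2 : ℝ) with hI
    have h1 := two_mul_volume_le_of_subset_Icc hρ
      (Nat.cast_lt.2 (hc p (Finset.mem_insert_self p c))) hl hz hK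
      (hA.inter measurableSet_Icc) (inter_subset_right : A ∩ I ⊆ I)
    have h2 := ih (fun q hq => hc q (Finset.mem_insert_of_mem hq))
      (hA.diff (measurableSet_Icc : MeasurableSet I)) (by
        intro t ht
        have := hAc ht.1
        rw [Finset.set_biUnion_insert] at this
        exact this.resolve_left ht.2)
    have h3 := rieszEnergy_inter_add_diff_le ρ A (measurableSet_Icc : MeasurableSet I)
    rw [Finset.sum_insert hp, ← measure_inter_add_sdiff A (measurableSet_Icc : MeasurableSet I)]
    calc _ = 2 * (ENNReal.ofReal z * volume (A ∩ I)) +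
          2 * (ENNReal.ofReal z * volume (A \ I)) := by ring
      _ ≤ _ := add_le_add h1 h2
      _ = ENNReal.ofReal K * (ENNReal.ofReal ((((p.2 : ℝ) - (p.1 : ℝ)) / l) ^ ρ) +
            ∑ q ∈ c, ENNReal.ofReal ((((q.2 : ℝ) - (q.1 : ℝ)) / l) ^ ρ)) +
          ENNReal.ofReal K⁻¹ * (ENNReal.ofReal (z ^ 2 * l ^ ρ) *
            (rieszEnergy ρ (A ∩ I) + rieszEnergy ρ (A \ I))) := by ring
      _ ≤ _ := by gcongr

lemma measurableSet_Sblock (n : ℕ) : MeasurableSet (Sblock n) := measurableSet_Ico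

/-- The times of the block `Sblock n` at which `f` is within distance `r` of `x`. -/
def nearSet (f : ℝ → ℝ) (x r : ℝ) (n : ℕ) : Set ℝ := Sblock n ∩ {t | |f t - x| ≤ r}

lemma exists_nearSet_subset {f : ℝ → ℝ} (hf : Continuous f) {x : ℝ}
    (hx : ∀ k : ℕ, 1 ≤ k → f k ≠ x) {n : ℕ} {c : Finset (ℕ × ℕ)}
    (hc : IsProperCover n {t | 0 ≤ t ∧ f t = x} c) :
    ∃ r₀ : ℝ, 0 < r₀ ∧ ∀ r < r₀, nearSet f x r n ⊆ ⋃ p ∈ c, Icc (p.1 : ℝ) (p.2 : ℝ) := by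
  set V : Set ℝ := ⋃ p ∈ c, Ioo (p.1 : ℝ) (p.2 : ℝ) with hV
  have hVo : IsOpen V := isOpen_biUnion fun p _ => isOpen_Ioo
  set F : Set ℝ := Icc ((2 : ℝ) ^ n) (2 ^ (n + 1)) \ V with hF
  have hFc : IsCompact F := isCompact_Icc.diff hVo
  have hne : ∀ t ∈ F, f t ≠ x := by
    rintro t ⟨⟨ht1, ht2⟩, htV⟩ htx
    have hnat : ∀ k : ℕ, 1 ≤ k → (k : ℝ) ≠ t := fun k hk hkt => hx k hk (hkt ▸ htx)
    have hpow : (2 : ℝ) ^ (n + 1) ≠ t := by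
      have := hnat (2 ^ (n + 1)) Nat.one_le_two_pow
      push_cast at this
      exact this
    have h0 : (0 : ℝ) < 2 ^ n := by positivity
    have hmem := hc.2 ⟨⟨h0.le.trans ht1, htx⟩, ⟨ht1, lt_of_le_of_ne ht2 hpow.symm⟩⟩
    simp only [mem_iUnion] at hmem
    obtain ⟨p, hp, hp1, hp2⟩ := hmem
    obtain ⟨hlt, hge, -⟩ := hc.1 p hp
    have hp1' : 1 ≤ p.1 := by
      have : (1 : ℝ) ≤ p.1 := (one_le_pow₀ one_le_two).trans hge
      exact_mod_cast this
    refine htV (mem_biUnion hp ⟨lt_of_le_of_ne hp1 (hnat _ hp1'), lt_of_le_of_ne hp2 ?_⟩)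
    exact (hnat _ (hp1'.trans hlt.le)).symm
  obtain ⟨r₀, hr₀, hr⟩ : ∃ r₀ : ℝ, 0 < r₀ ∧ ∀ t ∈ F, r₀ ≤ |f t - x| := by
    rcases F.eq_empty_or_nonempty with h | h
    · exact ⟨1, one_pos, by simp [h]⟩
    · obtain ⟨t, ht, hmin⟩ := hFc.exists_isMinOn h
        (f := fun t => |f t - x|) (by fun_prop)
      exact ⟨|f t - x|, abs_pos.2 (sub_ne_zero.2 (hne t ht)), fun s hs => hmin hs⟩
  refine ⟨r₀, hr₀, fun r hrr t ht => ?_⟩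
  by_contra hcon
  have htV : t ∉ V := fun h => hcon (iUnion₂_mono (fun p _ => Ioo_subset_Icc_self) h)
  have h1 : |f t - x| ≤ r := ht.2
  exact absurd (hr t ⟨⟨ht.1.1, ht.1.2.le⟩, htV⟩) (not_le.2 (h1.trans_lt hrr))

lemma measurableSet_nearSet {f : ℝ → ℝ} (hf : Continuous f) (x r : ℝ) (n : ℕ) :
    MeasurableSet (nearSet f x r n) :=
  (measurableSet_Sblock n).inter (isClosed_le (by fun_prop) continuous_const).measurableSet

lemma exists_two_mul_volume_nearSet_le {f : ℝ → ℝ} (hf : Continuous f) {x : ℝ}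
    (hx : ∀ k : ℕ, 1 ≤ k → f k ≠ x) {ρ K : ℝ} (hρ : 0 ≤ ρ) (hK : 0 < K) {n : ℕ}
    (hν : nu ρ n {t | 0 ≤ t ∧ f t = x} ≠ ∞) {ε : ℝ≥0∞} (hε : ε ≠ 0) :
    ∃ r₀ : ℝ, 0 < r₀ ∧ ∀ r < r₀, ∀ z : ℝ, 0 ≤ z →
      2 * (ENNReal.ofReal z * volume (nearSet f x r n)) ≤
        ENNReal.ofReal K * (nu ρ n {t | 0 ≤ t ∧ f t = x} + ε) +
        ENNReal.ofReal K⁻¹ * (ENNReal.ofReal (z ^ 2 * (2 ^ (n + 1)) ^ ρ) *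
          rieszEnergy ρ (nearSet f x r n)) := by
  have h : nu ρ n {t | 0 ≤ t ∧ f t = x} < nu ρ n {t | 0 ≤ t ∧ f t = x} + ε :=
    ENNReal.lt_add_right hν hε
  conv_lhs at h => rw [nu]
  simp only [iInf_lt_iff] at h
  obtain ⟨c, hc, hlt⟩ := h
  obtain ⟨r₀, hr₀, hsub⟩ := exists_nearSet_subset hf hx hc
  refine ⟨r₀, hr₀, fun r hr z hz => ?_⟩
  refine (two_mul_volume_le_of_subset_biUnion hρ (by positivity : (0 : ℝ) < 2 ^ (n + 1)) hz hK c
    (fun p hp => (hc.1 p hp).1) (measurableSet_nearSet hf x r n) (hsub r hr)).trans ?_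
  gcongr

lemma nu_anti {ρ ρ' : ℝ} (h : ρ ≤ ρ') (n : ℕ) (E : Set ℝ) : nu ρ' n E ≤ nu ρ n E := by
  refine iInf₂_mono fun c hc => Finset.sum_le_sum fun p hp => ENNReal.ofReal_le_ofReal ?_
  obtain ⟨h1, h2, h3⟩ := hc.1 p hp
  have h4 : (p.1 : ℝ) < p.2 := Nat.cast_lt.2 h1
  refine Real.rpow_le_rpow_of_exponent_ge (div_pos (sub_pos.2 h4) (by positivity)) ?_ h
  rw [div_le_one (by positivity)]
  have : (0 : ℝ) < 2 ^ n := by positivity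
  linarith

section Fubini

variable {Ω : Type*} [MeasurableSpace Ω] {P : Measure Ω} [SFinite P] {B : ℝ → Ω → ℝ}

lemma measurable_indicator_near (hm : ∀ t, Measurable (B t)) (hc : ∀ ω, Continuous fun t => B t ω)
    (x r : ℝ) : Measurable fun p : ℝ × Ω => {t | |B t p.2 - x| ≤ r}.indicator (1 : ℝ → ℝ≥0∞) p.1 := by
  have hB : Measurable fun p : ℝ × Ω => B p.1 p.2 :=
    measurable_uncurry_of_continuous_of_measurable hc hm
  have hS : MeasurableSet {p : ℝ × Ω | |B p.1 p.2 - x| ≤ r} :=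
    measurableSet_le (hB.sub_const x).abs measurable_const
  exact (measurable_one (α := ℝ≥0∞)).indicator hS

lemma setLIntegral_nearSet {f : ℝ → ℝ} (hf : Continuous f) (x r : ℝ) (n : ℕ) (g : ℝ → ℝ≥0∞) :
    ∫⁻ t in nearSet f x r n, g t =
      ∫⁻ t in Sblock n, {t | |f t - x| ≤ r}.indicator 1 t * g t := by
  have hS : MeasurableSet {t | |f t - x| ≤ r} :=
    (isClosed_le (by fun_prop) continuous_const).measurableSet
  rw [nearSet, inter_comm, ← Measure.restrict_restrict hS, ← lintegral_indicator hS]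
  refine lintegral_congr fun t => ?_
  by_cases h : t ∈ {t | |f t - x| ≤ r} <;> simp [h]

lemma measurable_lintegral_nearSet (hm : ∀ t, Measurable (B t))
    (hc : ∀ ω, Continuous fun t => B t ω) (x r : ℝ) (n m : ℕ) {g : ℝ → ℝ → ℝ≥0∞}
    (hg : Measurable (Function.uncurry g)) :
    Measurable fun ω => ∫⁻ t in nearSet (fun t => B t ω) x r n,
      ∫⁻ s in nearSet (fun t => B t ω) x r m, g t s := by
  have hχ := measurable_indicator_near hm hc x r
  simp_rw [setLIntegral_nearSet (hc _) x r]
  refine Measurable.lintegral_prod_right' (f := fun q : Ω × ℝ =>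
    {t | |B t q.1 - x| ≤ r}.indicator (1 : ℝ → ℝ≥0∞) q.2 *
      ∫⁻ s in Sblock m, {t | |B t q.1 - x| ≤ r}.indicator 1 s * g q.2 s) ?_
  refine (hχ.comp measurable_swap).mul ?_
  refine Measurable.lintegral_prod_right' (f := fun q : (Ω × ℝ) × ℝ =>
    {t | |B t q.1.1 - x| ≤ r}.indicator (1 : ℝ → ℝ≥0∞) q.2 * g q.1.2 q.2) ?_
  exact (hχ.comp (measurable_snd.prodMk (measurable_fst.comp measurable_fst))).mul
    (hg.comp ((measurable_snd.comp measurable_fst).prodMk measurable_snd))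

lemma lintegral_lintegral_nearSet (hm : ∀ t, Measurable (B t))
    (hc : ∀ ω, Continuous fun t => B t ω) (x r : ℝ) (n m : ℕ) {g : ℝ → ℝ → ℝ≥0∞}
    (hg : Measurable (Function.uncurry g)) :
    ∫⁻ ω, (∫⁻ t in nearSet (fun t => B t ω) x r n,
        ∫⁻ s in nearSet (fun t => B t ω) x r m, g t s) ∂P =
      ∫⁻ t in Sblock n, ∫⁻ s in Sblock m,
        g t s * P ({ω | |B t ω - x| ≤ r} ∩ {ω | |B s ω - x| ≤ r}) := by
  have hχ := measurable_indicator_near hm hc x r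
  have hN : ∀ t, MeasurableSet {ω | |B t ω - x| ≤ r} := fun t =>
    measurableSet_le ((hm t).sub_const x).abs measurable_const
  simp_rw [setLIntegral_nearSet (hc _) x r]
  rw [lintegral_lintegral_swap]
  · refine lintegral_congr fun t => ?_
    have h1 : ∀ ω, {t | |B t ω - x| ≤ r}.indicator (1 : ℝ → ℝ≥0∞) t *
        ∫⁻ s in Sblock m, {t | |B t ω - x| ≤ r}.indicator 1 s * g t s =
        ∫⁻ s in Sblock m, {t | |B t ω - x| ≤ r}.indicator (1 : ℝ → ℝ≥0∞) t *
          ({t | |B t ω - x| ≤ r}.indicator 1 s * g t s) := fun ω => by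
      rw [lintegral_const_mul]
      exact (hχ.comp measurable_prodMk_right).mul (hg.comp measurable_prodMk_left)
    simp_rw [h1]
    rw [lintegral_lintegral_swap]
    · refine lintegral_congr fun s => ?_
      rw [← lintegral_indicator_const ((hN t).inter (hN s))]
      refine lintegral_congr fun ω => ?_
      by_cases ht : |B t ω - x| ≤ r <;> by_cases hs : |B s ω - x| ≤ r <;>
        simp [indicator, ht, hs]
    · refine Measurable.aemeasurable ?_
      exact (hχ.comp (measurable_const.prodMk measurable_fst)).mul
        ((hχ.comp measurable_swap).mul (hg.comp (measurable_const.prodMk measurable_snd)))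
  · refine Measurable.aemeasurable ?_
    refine (hχ.comp measurable_swap).mul ?_
    refine Measurable.lintegral_prod_right' (f := fun q : (Ω × ℝ) × ℝ =>
      {t | |B t q.1.1 - x| ≤ r}.indicator (1 : ℝ → ℝ≥0∞) q.2 * g q.1.2 q.2) ?_
    exact (hχ.comp (measurable_snd.prodMk (measurable_fst.comp measurable_fst))).mul
      (hg.comp ((measurable_snd.comp measurable_fst).prodMk measurable_snd))

lemma measurable_volume_nearSet (hm : ∀ t, Measurable (B t))
    (hc : ∀ ω, Continuous fun t => B t ω) (x r : ℝ) (n : ℕ) :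
    Measurable fun ω => volume (nearSet (fun t => B t ω) x r n) := by
  have hχ := measurable_indicator_near hm hc x r
  simp_rw [← setLIntegral_one, setLIntegral_nearSet (hc _) x r, mul_one]
  exact Measurable.lintegral_prod_right' (f := fun q : Ω × ℝ =>
    {t | |B t q.1 - x| ≤ r}.indicator (1 : ℝ → ℝ≥0∞) q.2) (hχ.comp measurable_swap)

lemma lintegral_volume_nearSet (hm : ∀ t, Measurable (B t))
    (hc : ∀ ω, Continuous fun t => B t ω) (x r : ℝ) (n : ℕ) :
    ∫⁻ ω, volume (nearSet (fun t => B t ω) x r n) ∂P =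
      ∫⁻ t in Sblock n, P {ω | |B t ω - x| ≤ r} := by
  have hχ := measurable_indicator_near hm hc x r
  have hN : ∀ t, MeasurableSet {ω | |B t ω - x| ≤ r} := fun t =>
    measurableSet_le ((hm t).sub_const x).abs measurable_const
  simp_rw [← setLIntegral_one (nearSet _ _ _ _), setLIntegral_nearSet (hc _) x r, mul_one]
  rw [lintegral_lintegral_swap]
  · refine lintegral_congr fun t => ?_
    rw [← lintegral_indicator_one (hN t)]
    rfl
  · exact (hχ.comp measurable_swap).aemeasurable

end Fubini

lemma setLIntegral_rpow_neg_Ioc {γ a : ℝ} (hγ : γ < 1) (ha : 0 ≤ a) :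
    ∫⁻ u in Ioc 0 a, ENNReal.ofReal (u ^ (-γ)) = ENNReal.ofReal (a ^ (1 - γ) / (1 - γ)) := by
  have hint : IntervalIntegrable (fun u : ℝ => u ^ (-γ)) volume 0 a :=
    intervalIntegral.intervalIntegrable_rpow' (by linarith)
  have h := ofReal_integral_eq_lintegral_ofReal
    ((intervalIntegrable_iff_integrableOn_Ioc_of_le ha).1 hint)
    (ae_restrict_of_forall_mem measurableSet_Ioc fun u hu => Real.rpow_nonneg hu.1.le _)
  rw [← h, ← intervalIntegral.integral_of_le ha, integral_rpow (Or.inl (by linarith)),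
    Real.zero_rpow (by linarith)]
  congr 1
  ring_nf

lemma setLIntegral_rpow_neg_Sblock {γ : ℝ} (hγ : γ < 1) (n : ℕ) :
    ∫⁻ t in Sblock n, ENNReal.ofReal (t ^ (-γ)) =
      ENNReal.ofReal (((2 : ℝ) ^ n) ^ (1 - γ) * ((2 ^ (1 - γ) - 1) / (1 - γ))) := by
  have hle : (2 : ℝ) ^ n ≤ 2 ^ (n + 1) := pow_le_pow_right₀ one_le_two n.le_succ
  have hpos : (0 : ℝ) < 2 ^ n := by positivity
  have hint : IntervalIntegrable (fun u : ℝ => u ^ (-γ)) volume (2 ^ n) (2 ^ (n + 1)) :=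
    intervalIntegral.intervalIntegrable_rpow' (by linarith)
  have h := ofReal_integral_eq_lintegral_ofReal
    ((intervalIntegrable_iff_integrableOn_Ioc_of_le hle).1 hint)
    (ae_restrict_of_forall_mem measurableSet_Ioc fun u hu =>
      Real.rpow_nonneg (hpos.trans hu.1).le _)
  rw [Sblock, restrict_Ico_eq_restrict_Ioc, ← h, ← intervalIntegral.integral_of_le hle,
    integral_rpow (Or.inl (by linarith)), pow_succ,
    Real.mul_rpow hpos.le two_pos.le, show -γ + 1 = 1 - γ by ring]
  congr 1
  ring

lemma setLIntegral_abs_sub_rpow_neg_le {γ : ℝ} (hγ : γ < 1) (n : ℕ) {t : ℝ} (ht : t ∈ Sblock n) :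
    ∫⁻ s in Sblock n, ENNReal.ofReal (|t - s| ^ (-γ)) ≤
      ENNReal.ofReal (2 * (((2 : ℝ) ^ n) ^ (1 - γ) / (1 - γ))) := by
  set a : ℝ := 2 ^ n with ha
  have ha0 : 0 < a := by positivity
  set g : ℝ → ℝ≥0∞ := (Ioc 0 a).indicator fun u => ENNReal.ofReal (u ^ (-γ)) with hg
  have hgm : Measurable g := by
    refine Measurable.indicator ?_ measurableSet_Ioc
    fun_prop
  have hgint : ∫⁻ u, g u = ENNReal.ofReal (a ^ (1 - γ) / (1 - γ)) := by
    rw [hg, lintegral_indicator measurableSet_Ioc, setLIntegral_rpow_neg_Ioc hγ ha0.le]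
  have hpt : ∀ᵐ s ∂(volume.restrict (Sblock n)),
      ENNReal.ofReal (|t - s| ^ (-γ)) ≤ g (t - s) + g (s - t) := by
    have hne : ∀ᵐ s ∂(volume.restrict (Sblock n)), s ≠ t :=
      ae_restrict_of_ae (Measure.ae_ne volume t)
    filter_upwards [hne, ae_restrict_mem (measurableSet_Sblock n)] with s hs hsS
    obtain ⟨t1, t2⟩ := ht
    obtain ⟨s1, s2⟩ := hsS
    rw [pow_succ, ← ha] at t2 s2
    rcases hs.lt_or_gt with h | h
    · rw [abs_of_pos (sub_pos.2 h)]
      refine le_add_right (le_of_eq ?_)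
      rw [hg, indicator_of_mem (show t - s ∈ Ioc 0 a from ⟨by linarith, by linarith⟩)]
    · rw [abs_sub_comm, abs_of_pos (sub_pos.2 h)]
      refine le_add_left (le_of_eq ?_)
      rw [hg, indicator_of_mem (show s - t ∈ Ioc 0 a from ⟨by linarith, by linarith⟩)]
  calc ∫⁻ s in Sblock n, ENNReal.ofReal (|t - s| ^ (-γ))
      ≤ ∫⁻ s in Sblock n, (g (t - s) + g (s - t)) := lintegral_mono_ae hpt
    _ ≤ ∫⁻ s, (g (t - s) + g (s - t)) := setLIntegral_le_lintegral _ _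
    _ = (∫⁻ s, g s) + ∫⁻ s, g s := by
        rw [lintegral_add_left (by fun_prop), lintegral_sub_left_eq_self,
          lintegral_sub_right_eq_self]
    _ = _ := by
        rw [hgint, ← ENNReal.ofReal_add] <;> [ring_nf; skip; skip] <;>
          exact div_nonneg (Real.rpow_nonneg ha0.le _) (by linarith)

/-- The normalising factor of the occupation time of `[x - r, x + r]` in the block `Sblock n`. -/
def occScale (H r : ℝ) (n : ℕ) : ℝ := (((2 : ℝ) ^ n) ^ (1 - H) * (2 * r))⁻¹

lemma occScale_pos {H r : ℝ} (hr : 0 < r) (n : ℕ) : 0 < occScale H r n := by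
  unfold occScale; positivity

/-- The limiting mean of the normalised occupation time. -/
def occMean (H : ℝ) : ℝ := (√(2 * Real.pi))⁻¹ * ((2 ^ (1 - H) - 1) / (1 - H))

lemma occMean_pos {H : ℝ} (hH : H < 1) : 0 < occMean H := by
  have h1 : 1 < (2 : ℝ) ^ (1 - H) := Real.one_lt_rpow one_lt_two (by linarith)
  have h2 : 0 < (2 ^ (1 - H) - 1) / (1 - H) := div_pos (by linarith) (by linarith)
  unfold occMean
  positivity

/-- The normalised occupation time of `[x - r, x + r]` in the block `Sblock n`. -/
def normOcc (H : ℝ) (f : ℝ → ℝ) (x r : ℝ) (n : ℕ) : ℝ≥0∞ :=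
  ENNReal.ofReal (occScale H r n) * volume (nearSet f x r n)

/-- The normalised Riesz energy of the occupation measure of `[x - r, x + r]` in `Sblock n`. -/
def normEnergy (H ρ : ℝ) (f : ℝ → ℝ) (x r : ℝ) (n : ℕ) : ℝ≥0∞ :=
  ENNReal.ofReal (occScale H r n ^ 2 * (2 ^ (n + 1)) ^ ρ) * rieszEnergy ρ (nearSet f x r n)

lemma normOcc_sq_le {H ρ : ℝ} (hρ : 0 ≤ ρ) {f : ℝ → ℝ} (hf : Continuous f) (x r : ℝ) (n : ℕ) :
    normOcc H f x r n ^ 2 ≤ normEnergy H ρ f x r n := by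
  have h := le_rieszEnergy (p := 2 ^ n) (q := 2 ^ (n + 1)) hρ (measurableSet_nearSet hf x r n)
    (fun t ht => ⟨ht.1.1, ht.1.2.le⟩)
  rw [normOcc, normEnergy, mul_pow]
  refine le_trans ?_ (mul_le_mul_right h _)
  rw [← mul_assoc]
  refine mul_le_mul_left ?_ _
  have hpos : (0 : ℝ) < 2 ^ (n + 1) - 2 ^ n := by
    rw [pow_succ]; have : (0 : ℝ) < 2 ^ n := by positivity
    linarith
  by_cases hz : 0 ≤ occScale H r n
  · rw [ENNReal.ofReal_rpow_of_pos hpos, ← ENNReal.ofReal_mul (by positivity),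
      ← ENNReal.ofReal_pow hz]
    refine ENNReal.ofReal_le_ofReal ?_
    rw [mul_assoc]
    refine le_mul_of_one_le_right (by positivity) ?_
    rw [Real.rpow_neg hpos.le, ← div_eq_mul_inv, one_le_div (Real.rpow_pos_of_pos hpos _)]
    refine Real.rpow_le_rpow hpos.le ?_ hρ
    have : (0 : ℝ) < 2 ^ n := by positivity
    linarith
  · rw [ENNReal.ofReal_of_nonpos (not_le.1 hz).le]
    simp

lemma measurable_normOcc {Ω : Type*} [MeasurableSpace Ω] {B : ℝ → Ω → ℝ}
    (hm : ∀ t, Measurable (B t)) (hc : ∀ ω, Continuous fun t => B t ω) (H x r : ℝ) (n : ℕ) :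
    Measurable fun ω => normOcc H (fun t => B t ω) x r n :=
  (measurable_volume_nearSet hm hc x r n).const_mul _

lemma measurable_normEnergy {Ω : Type*} [MeasurableSpace Ω] {B : ℝ → Ω → ℝ}
    (hm : ∀ t, Measurable (B t)) (hc : ∀ ω, Continuous fun t => B t ω) (H ρ x r : ℝ) (n : ℕ) :
    Measurable fun ω => normEnergy H ρ (fun t => B t ω) x r n :=
  (measurable_lintegral_nearSet hm hc x r n n (measurable_rieszKernel ρ)).const_mul _

lemma normOcc_ne_top (H : ℝ) (f : ℝ → ℝ) (x r : ℝ) (n : ℕ) : normOcc H f x r n ≠ ∞ := by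
  refine ENNReal.mul_ne_top ENNReal.ofReal_ne_top ?_
  exact ((measure_mono (inter_subset_left : nearSet f x r n ⊆ Sblock n)).trans_lt
    measure_Ico_lt_top).ne

/-- A bound for the mean of the normalised Riesz energy. -/
def energyBound (H ρ : ℝ) : ℝ :=
  2 ^ (ρ + 1) * (2 * Real.pi * √((1 - H) / 2))⁻¹ / (1 - (ρ + H))

lemma energyBound_nonneg {H ρ : ℝ} (h : ρ + H < 1) : 0 ≤ energyBound H ρ := by
  have : 0 < 1 - (ρ + H) := by linarith
  unfold energyBound
  positivity

namespace IsFractionalBrownianMotion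

variable {Ω : Type*} [MeasurableSpace Ω] {P : Measure Ω} [IsProbabilityMeasure P] {H : ℝ}
  {B : ℝ → Ω → ℝ}

lemma exists_le_lintegral_normOcc (hB : IsFractionalBrownianMotion P H B)
    (hc : ∀ ω, Continuous fun t => B t ω) (hH : H ∈ Ioo (0 : ℝ) 1) (x : ℝ) {η : ℝ}
    (hη : 0 < η) (hη1 : η ≤ 1) :
    ∃ n₀ : ℕ, ∀ n, n₀ ≤ n → ∀ r : ℝ, 0 < r → r ≤ 1 →
      ENNReal.ofReal (occMean H * (1 - η)) ≤ ∫⁻ ω, normOcc H (fun t => B t ω) x r n ∂P := by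
  obtain ⟨t₀, -, h⟩ := hB.exists_le_measure_near hH.1 x hη
  obtain ⟨n₀, hn₀⟩ := pow_unbounded_of_one_lt t₀ (one_lt_two : (1 : ℝ) < 2)
  refine ⟨n₀, fun n hn r hr hr1 => ?_⟩
  have hη' : 0 ≤ 1 - η := by linarith
  have hb := occMean_pos hH.2
  unfold normOcc
  rw [lintegral_const_mul _ (measurable_volume_nearSet hB.measurable hc x r n),
    lintegral_volume_nearSet hB.measurable hc]
  have h1 : ∫⁻ t in Sblock n, ENNReal.ofReal (2 * r * (√(2 * Real.pi))⁻¹ * (1 - η)) *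
      ENNReal.ofReal (t ^ (-H)) ≤ ∫⁻ t in Sblock n, P {ω | |B t ω - x| ≤ r} := by
    refine setLIntegral_mono' (measurableSet_Sblock n) fun t ht => ?_
    rw [← ENNReal.ofReal_mul (by positivity)]
    refine le_trans (ENNReal.ofReal_le_ofReal (le_of_eq ?_)) (h t r ?_ hr.le hr1)
    · ring
    · exact hn₀.le.trans ((pow_le_pow_right₀ one_le_two hn).trans ht.1)
  refine le_trans ?_ (mul_le_mul_right h1 _)
  rw [lintegral_const_mul _ (by fun_prop), setLIntegral_rpow_neg_Sblock hH.2,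
    ← ENNReal.ofReal_mul (by positivity), ← ENNReal.ofReal_mul (occScale_pos hr n).le]
  refine ENNReal.ofReal_le_ofReal (le_of_eq ?_)
  have : 0 < ((2 : ℝ) ^ n) ^ (1 - H) := by positivity
  rw [occMean, occScale]
  field_simp

lemma exists_lintegral_normOcc_mul_le (hB : IsFractionalBrownianMotion P H B)
    (hc : ∀ ω, Continuous fun t => B t ω) (hH : H ∈ Ioo (0 : ℝ) 1) {η : ℝ} (hη : 0 < η) :
    ∃ d : ℕ, ∀ n m : ℕ, n + d ≤ m → ∀ x r : ℝ, 0 < r →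
      ∫⁻ ω, normOcc H (fun t => B t ω) x r n * normOcc H (fun t => B t ω) x r m ∂P ≤
        ENNReal.ofReal (occMean H ^ 2 * (1 + η)) := by
  obtain ⟨T, hT, h⟩ := hB.exists_measure_near_inter_le hH hη
  obtain ⟨d, hd⟩ := pow_unbounded_of_one_lt T (one_lt_two : (1 : ℝ) < 2)
  refine ⟨d + 1, fun n m hnm x r hr => ?_⟩
  have hb := occMean_pos hH.2
  have hsn := occScale_pos (H := H) hr n
  have hsm := occScale_pos (H := H) hr m
  have hprod : ∀ ω, normOcc H (fun t => B t ω) x r n * normOcc H (fun t => B t ω) x r m =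
      ENNReal.ofReal (occScale H r n * occScale H r m) *
        ∫⁻ t in nearSet (fun t => B t ω) x r n, ∫⁻ s in nearSet (fun t => B t ω) x r m, 1 := by
    intro ω
    simp only [setLIntegral_const, normOcc, ENNReal.ofReal_mul hsn.le, one_mul]
    ring
  simp_rw [hprod]
  have hone : Measurable (Function.uncurry fun _ _ : ℝ => (1 : ℝ≥0∞)) := measurable_const
  rw [lintegral_const_mul _ (measurable_lintegral_nearSet hB.measurable hc x r n m hone),
    lintegral_lintegral_nearSet hB.measurable hc x r n m hone]
  have h1 : ∫⁻ t in Sblock n, ∫⁻ s in Sblock m,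
      1 * P ({ω | |B t ω - x| ≤ r} ∩ {ω | |B s ω - x| ≤ r}) ≤
      ∫⁻ t in Sblock n, ∫⁻ s in Sblock m,
        (ENNReal.ofReal (2 * r * (√(2 * Real.pi))⁻¹) * ENNReal.ofReal (t ^ (-H))) *
          (ENNReal.ofReal (2 * r * (√(2 * Real.pi))⁻¹ * (1 + η)) * ENNReal.ofReal (s ^ (-H))) := by
    refine setLIntegral_mono' (measurableSet_Sblock n) fun t ht =>
      setLIntegral_mono' (measurableSet_Sblock m) fun s hs => ?_
    have ht0 : 0 < t := lt_of_lt_of_le (by positivity) ht.1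
    rw [one_mul, ← ENNReal.ofReal_mul (by positivity), ← ENNReal.ofReal_mul (by positivity)]
    refine (h t s x r ht0 ?_ hr.le).trans (le_of_eq ?_)
    · calc T * t ≤ 2 ^ d * 2 ^ (n + 1) :=
            mul_le_mul hd.le ht.2.le ht0.le (by positivity)
        _ = 2 ^ (n + (d + 1)) := by ring
        _ ≤ 2 ^ m := pow_le_pow_right₀ one_le_two hnm
        _ ≤ s := hs.1
    · congr 2; ring
  refine (mul_le_mul_right h1 _).trans ?_
  have hm1 : Measurable fun s : ℝ => ENNReal.ofReal (s ^ (-H)) := by fun_prop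
  simp_rw [lintegral_const_mul _ (hm1.const_mul _), lintegral_const_mul _ hm1]
  rw [lintegral_mul_const _ (hm1.const_mul _), lintegral_const_mul _ hm1,
    setLIntegral_rpow_neg_Sblock hH.2, setLIntegral_rpow_neg_Sblock hH.2,
    ← ENNReal.ofReal_mul (by positivity), ← ENNReal.ofReal_mul (by positivity)]
  have hpos : ∀ k : ℕ, 0 < ((2 : ℝ) ^ k) ^ (1 - H) := fun k => by positivity
  have hn := hpos n
  have hm' := hpos m
  have hq : 0 < ((2 : ℝ) ^ (1 - H) - 1) / (1 - H) :=
    div_pos (sub_pos.2 (Real.one_lt_rpow one_lt_two (by linarith [hH.2]))) (by linarith [hH.2])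
  rw [← ENNReal.ofReal_mul (by positivity), ← ENNReal.ofReal_mul (by positivity)]
  refine ENNReal.ofReal_le_ofReal (le_of_eq ?_)
  rw [occMean, occScale, occScale]
  set q := ((2 : ℝ) ^ (1 - H) - 1) / (1 - H)
  field_simp

lemma lintegral_normEnergy_le (hB : IsFractionalBrownianMotion P H B)
    (hc : ∀ ω, Continuous fun t => B t ω) (hH : H ∈ Ioo (0 : ℝ) 1) {ρ : ℝ}
    (hρH : ρ + H < 1) (x : ℝ) {r : ℝ} (hr : 0 < r) (n : ℕ) :
    ∫⁻ ω, normEnergy H ρ (fun t => B t ω) x r n ∂P ≤ ENNReal.ofReal (energyBound H ρ) := by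
  unfold normEnergy rieszEnergy
  rw [lintegral_const_mul _ (measurable_lintegral_nearSet hB.measurable hc x r n n
    (measurable_rieszKernel ρ)), lintegral_lintegral_nearSet hB.measurable hc x r n n
    (measurable_rieszKernel ρ)]
  set a : ℝ := 2 ^ n with ha
  have ha0 : 0 < a := by positivity
  set D : ℝ := (2 * Real.pi * √((1 - H) / 2))⁻¹ with hD
  have hγ : 0 < 1 - (ρ + H) := by linarith
  have hpt : ∀ t ∈ Sblock n, ∫⁻ s in Sblock n, rieszKernel ρ t s *
      P ({ω | |B t ω - x| ≤ r} ∩ {ω | |B s ω - x| ≤ r}) ≤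
      ENNReal.ofReal ((2 * r) ^ 2 * (D * a ^ (-H))) *
        ENNReal.ofReal (2 * (a ^ (1 - (ρ + H)) / (1 - (ρ + H)))) := by
    intro t ht
    refine le_trans ?_ (mul_le_mul_right (setLIntegral_abs_sub_rpow_neg_le hρH n ht) _)
    rw [← lintegral_const_mul _ (by fun_prop)]
    refine lintegral_mono_ae ?_
    have hne : ∀ᵐ s ∂(volume.restrict (Sblock n)), s ≠ t :=
      ae_restrict_of_ae (Measure.ae_ne volume t)
    filter_upwards [hne, ae_restrict_mem (measurableSet_Sblock n)] with s hs hsS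
    have hmem : ∀ u ∈ Sblock n, u ∈ Icc a (2 * a) := fun u hu =>
      ⟨hu.1, by have := hu.2.le; rwa [pow_succ, mul_comm] at this⟩
    have hd : 0 < |t - s| := abs_pos.2 (sub_ne_zero.2 hs.symm)
    have hP := hB.measure_near_inter_le_of_ne hH ha0 (hmem t ht) (hmem s hsS) hs.symm x hr.le
    rw [abs_sub_comm s t] at hP
    refine (mul_le_mul_right hP _).trans (le_of_eq ?_)
    rw [rieszKernel, ENNReal.ofReal_rpow_of_pos hd, ← ENNReal.ofReal_mul (by positivity),
      ← ENNReal.ofReal_mul (by positivity), neg_add, Real.rpow_add hd]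
    congr 1
    ring
  have h1 := setLIntegral_mono' (μ := volume) (measurableSet_Sblock n) hpt
  refine (mul_le_mul_right h1 _).trans ?_
  have hvol : volume (Sblock n) = ENNReal.ofReal a := by
    rw [Sblock, Real.volume_Ico, pow_succ, ← ha]; congr 1; ring
  rw [setLIntegral_const, hvol, ← ENNReal.ofReal_mul (by positivity),
    ← ENNReal.ofReal_mul (by positivity), ← ENNReal.ofReal_mul (by positivity)]
  refine ENNReal.ofReal_le_ofReal (le_of_eq ?_)
  have hR : ∀ y : ℝ, 0 < a ^ y := fun y => Real.rpow_pos_of_pos ha0 y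
  have e1 : a ^ (1 - H) = a * (a ^ H)⁻¹ := by
    rw [Real.rpow_sub ha0, Real.rpow_one, div_eq_mul_inv]
  have e2 : a ^ (1 - (ρ + H)) = a * (a ^ ρ * a ^ H)⁻¹ := by
    rw [Real.rpow_sub ha0, Real.rpow_one, Real.rpow_add ha0, div_eq_mul_inv]
  have e3 : ((2 : ℝ) ^ (n + 1)) ^ ρ = a ^ ρ * 2 ^ ρ := by
    rw [pow_succ, Real.mul_rpow ha0.le two_pos.le]
  have h2 := hR H
  have h3 := hR ρ
  rw [occScale, ← ha, e1, e2, e3, Real.rpow_neg ha0.le, energyBound, ← hD,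
    Real.rpow_add_one two_ne_zero]
  field_simp

end IsFractionalBrownianMotion

section SecondMoment

variable {Ω ι : Type*} [MeasurableSpace Ω] {P : Measure Ω} [IsProbabilityMeasure P]
  {s : Finset ι} {b C η : ℝ}

lemma measure_sum_le_half_le_of_real {X : ι → Ω → ℝ} (hs : s.Nonempty) (hb : 0 < b)
    (hX : ∀ i ∈ s, MemLp (X i) 2 P) (h1 : ∀ i ∈ s, b * (1 - η) ≤ ∫ ω, X i ω ∂P)
    (h2 : ∀ i ∈ s, ∀ j ∈ s, i ≠ j → ∫ ω, X i ω * X j ω ∂P ≤ b ^ 2 * (1 + η))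
    (h3 : ∀ i ∈ s, ∫ ω, X i ω ^ 2 ∂P ≤ C) (hη : 0 ≤ η) :
    P.real {ω | ∑ i ∈ s, X i ω ≤ s.card * b / 2} ≤ 4 * (3 * η + C / (s.card * b ^ 2)) := by
  classical
  have hN : (0 : ℝ) < s.card := Nat.cast_pos.2 (Finset.card_pos.2 hs)
  set N : ℝ := (s.card : ℝ) with hNdef
  have hint : ∀ i ∈ s, Integrable (X i) P := fun i hi => (hX i hi).integrable (by norm_num)
  have hmul : ∀ i ∈ s, ∀ j ∈ s, Integrable (fun ω => X i ω * X j ω) P := fun i hi j hj =>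
    (hX i hi).integrable_mul (hX j hj)
  have hexp : ∀ ω, (∑ i ∈ s, X i ω - N * b) ^ 2 =
      (∑ i ∈ s, ∑ j ∈ s, X i ω * X j ω) - 2 * (N * b) * (∑ i ∈ s, X i ω) + (N * b) ^ 2 := by
    intro ω
    rw [← Finset.sum_mul_sum]; ring
  have hi1 : Integrable (fun ω => ∑ i ∈ s, ∑ j ∈ s, X i ω * X j ω) P :=
    integrable_finsetSum _ fun i hi => integrable_finsetSum _ fun j hj => hmul i hi j hj
  have hi2 : Integrable (fun ω => ∑ i ∈ s, X i ω) P := integrable_finsetSum _ hint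
  have hI : Integrable (fun ω => (∑ i ∈ s, X i ω - N * b) ^ 2) P := by
    simp_rw [hexp]
    exact (hi1.sub (hi2.const_mul _)).add (integrable_const _)
  have hval : ∫ ω, (∑ i ∈ s, X i ω - N * b) ^ 2 ∂P =
      (∑ i ∈ s, ∑ j ∈ s, ∫ ω, X i ω * X j ω ∂P) - 2 * (N * b) * (∑ i ∈ s, ∫ ω, X i ω ∂P) +
        (N * b) ^ 2 := by
    simp_rw [hexp]
    have hi3 : Integrable (fun ω => (∑ i ∈ s, ∑ j ∈ s, X i ω * X j ω) -
        2 * (N * b) * ∑ i ∈ s, X i ω) P := hi1.sub (hi2.const_mul _)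
    rw [integral_add hi3 (integrable_const _), integral_sub hi1 (hi2.const_mul _), integral_const_mul, integral_finsetSum _ hint,
      integral_finsetSum _ fun i hi => integrable_finsetSum _ fun j hj => hmul i hi j hj]
    simp only [integral_const, probReal_univ, smul_eq_mul, one_mul]
    congr 2
    exact Finset.sum_congr rfl fun i hi => integral_finsetSum _ fun j hj => hmul i hi j hj
  have hdouble : ∑ i ∈ s, ∑ j ∈ s, ∫ ω, X i ω * X j ω ∂P ≤
      N * (C + N * (b ^ 2 * (1 + η))) := by
    have hrow : ∀ i ∈ s, ∑ j ∈ s, ∫ ω, X i ω * X j ω ∂P ≤ C + N * (b ^ 2 * (1 + η)) := by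
      intro i hi
      rw [← Finset.add_sum_erase s _ hi]
      refine add_le_add ?_ ?_
      · simpa only [sq] using h3 i hi
      · calc ∑ j ∈ s.erase i, ∫ ω, X i ω * X j ω ∂P
            ≤ ∑ j ∈ s.erase i, b ^ 2 * (1 + η) := Finset.sum_le_sum fun j hj =>
              h2 i hi j (Finset.mem_of_mem_erase hj) (Finset.ne_of_mem_erase hj).symm
          _ ≤ ∑ j ∈ s, b ^ 2 * (1 + η) :=
              Finset.sum_le_sum_of_subset_of_nonneg (Finset.erase_subset _ _)
                fun _ _ _ => by positivity
          _ = _ := by rw [Finset.sum_const, nsmul_eq_mul]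
    calc _ ≤ ∑ i ∈ s, (C + N * (b ^ 2 * (1 + η))) := Finset.sum_le_sum hrow
      _ = _ := by rw [Finset.sum_const, nsmul_eq_mul]
  have hsingle : N * (b * (1 - η)) ≤ ∑ i ∈ s, ∫ ω, X i ω ∂P := by
    rw [hNdef, ← nsmul_eq_mul, ← Finset.sum_const]
    exact Finset.sum_le_sum h1
  have hupper : ∫ ω, (∑ i ∈ s, X i ω - N * b) ^ 2 ∂P ≤ 3 * η * (N * b) ^ 2 + N * C := by
    rw [hval]
    have := mul_le_mul_of_nonneg_left hsingle (by positivity : 0 ≤ 2 * (N * b))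
    nlinarith
  have hmk := mul_meas_ge_le_integral_of_nonneg
    (Filter.Eventually.of_forall fun ω => sq_nonneg (∑ i ∈ s, X i ω - N * b)) hI
    ((N * b) ^ 2 / 4)
  have hsub : P.real {ω | ∑ i ∈ s, X i ω ≤ N * b / 2} ≤
      P.real {ω | (N * b) ^ 2 / 4 ≤ (∑ i ∈ s, X i ω - N * b) ^ 2} := by
    refine measureReal_mono fun ω hω => ?_
    have h : ∑ i ∈ s, X i ω ≤ N * b / 2 := hω
    show (N * b) ^ 2 / 4 ≤ (∑ i ∈ s, X i ω - N * b) ^ 2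
    have hNb : 0 < N * b := by positivity
    nlinarith
  have hq : 0 < (N * b) ^ 2 / 4 := by positivity
  refine hsub.trans ?_
  rw [← mul_le_mul_iff_right₀ hq]
  refine (hmk.trans hupper).trans (le_of_eq ?_)
  field_simp

lemma measure_sum_le_half_le {Z : ι → Ω → ℝ≥0∞} (hs : s.Nonempty) (hb : 0 < b)
    (hm : ∀ i ∈ s, Measurable (Z i)) (hfin : ∀ i ∈ s, ∀ ω, Z i ω ≠ ∞)
    (h1 : ∀ i ∈ s, ENNReal.ofReal (b * (1 - η)) ≤ ∫⁻ ω, Z i ω ∂P)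
    (h2 : ∀ i ∈ s, ∀ j ∈ s, i ≠ j →
      ∫⁻ ω, Z i ω * Z j ω ∂P ≤ ENNReal.ofReal (b ^ 2 * (1 + η)))
    (hC : 0 ≤ C) (h3 : ∀ i ∈ s, ∫⁻ ω, Z i ω ^ 2 ∂P ≤ ENNReal.ofReal C) (hη : 0 ≤ η) :
    P {ω | ∑ i ∈ s, Z i ω ≤ ENNReal.ofReal (s.card * b / 2)} ≤
      ENNReal.ofReal (4 * (3 * η + C / (s.card * b ^ 2))) := by
  have hL : ∀ i ∈ s, MemLp (fun ω => (Z i ω).toReal) 2 P := by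
    intro i hi
    rw [memLp_two_iff_integrable_sq (hm i hi).ennreal_toReal.aestronglyMeasurable]
    simp_rw [← ENNReal.toReal_pow]
    exact integrable_toReal_of_lintegral_ne_top ((hm i hi).pow_const 2).aemeasurable
      ((h3 i hi).trans_lt ENNReal.ofReal_lt_top).ne
  have hI : ∀ {f : Ω → ℝ≥0∞}, Measurable f → (∀ ω, f ω ≠ ∞) →
      ∫ ω, (f ω).toReal ∂P = (∫⁻ ω, f ω ∂P).toReal := fun hf hf' =>
    integral_toReal hf.aemeasurable (Filter.Eventually.of_forall fun ω => (hf' ω).lt_top)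
  have key := measure_sum_le_half_le_of_real (X := fun i ω => (Z i ω).toReal) (C := C) (η := η)
    hs hb hL ?_ ?_ ?_ hη
  · have hset : {ω | ∑ i ∈ s, Z i ω ≤ ENNReal.ofReal (s.card * b / 2)} =
        {ω | ∑ i ∈ s, (Z i ω).toReal ≤ s.card * b / 2} := by
      ext ω
      show ∑ i ∈ s, Z i ω ≤ ENNReal.ofReal (s.card * b / 2) ↔
        ∑ i ∈ s, (Z i ω).toReal ≤ s.card * b / 2
      rw [← ENNReal.toReal_sum fun i hi => hfin i hi ω]
      exact ENNReal.le_ofReal_iff_toReal_le (ENNReal.sum_ne_top.2 fun i hi => hfin i hi ω)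
        (by positivity)
    rw [hset, ← ofReal_measureReal]
    exact ENNReal.ofReal_le_ofReal key
  · intro i hi
    rw [hI (hm i hi) (hfin i hi)]
    refine (ENNReal.ofReal_le_iff_le_toReal ?_).1 (h1 i hi)
    have h : ∫⁻ ω, Z i ω ∂P ≤ ∫⁻ ω, (1 + Z i ω ^ 2) ∂P := by
      refine lintegral_mono fun ω => ?_
      rcases le_total (Z i ω) 1 with h | h
      · exact le_add_right h
      · exact le_add_left (le_self_pow₀ h two_ne_zero)
    rw [lintegral_add_left measurable_const] at h
    refine (h.trans_lt (ENNReal.add_lt_top.2 ⟨by simp, ?_⟩)).ne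
    exact (h3 i hi).trans_lt ENNReal.ofReal_lt_top
  · intro i hi j hj hij
    simp_rw [← ENNReal.toReal_mul]
    rw [hI (f := fun ω => Z i ω * Z j ω) ((hm i hi).mul (hm j hj)) fun ω => ENNReal.mul_ne_top (hfin i hi ω) (hfin j hj ω)]
    exact ENNReal.toReal_le_of_le_ofReal (by positivity) (h2 i hi j hj hij)
  · intro i hi
    simp_rw [← ENNReal.toReal_pow]
    rw [hI ((hm i hi).pow_const 2) fun ω => ENNReal.pow_ne_top (hfin i hi ω)]
    exact ENNReal.toReal_le_of_le_ofReal hC (h3 i hi)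

lemma measure_two_mul_sum_le_le {Z W : ι → Ω → ℝ≥0∞} {K M : ℝ} (hs : s.Nonempty) (hb : 0 < b)
    (hm : ∀ i ∈ s, Measurable (Z i)) (hfin : ∀ i ∈ s, ∀ ω, Z i ω ≠ ∞)
    (h1 : ∀ i ∈ s, ENNReal.ofReal (b * (1 - η)) ≤ ∫⁻ ω, Z i ω ∂P)
    (h2 : ∀ i ∈ s, ∀ j ∈ s, i ≠ j →
      ∫⁻ ω, Z i ω * Z j ω ∂P ≤ ENNReal.ofReal (b ^ 2 * (1 + η)))
    (hC : 0 ≤ C) (hWm : ∀ i ∈ s, Measurable (W i)) (hZW : ∀ i ∈ s, ∀ ω, Z i ω ^ 2 ≤ W i ω)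
    (h3 : ∀ i ∈ s, ∫⁻ ω, W i ω ∂P ≤ ENNReal.ofReal C) (hη : 0 ≤ η) (hK : 0 < K)
    (hM : 2 * (K * M) ≤ s.card * b) :
    P {ω | 2 * ∑ i ∈ s, Z i ω ≤ ENNReal.ofReal (K * M) + ENNReal.ofReal K⁻¹ * ∑ i ∈ s, W i ω} ≤
      ENNReal.ofReal (4 * (3 * η + C / (s.card * b ^ 2))) + ENNReal.ofReal (2 * C / (K * b)) := by
  have hN : (0 : ℝ) < s.card := Nat.cast_pos.2 (Finset.card_pos.2 hs)
  set y : ℝ := s.card * b / 2 with hy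
  have hy0 : 0 < y := by positivity
  have hA := measure_sum_le_half_le (P := P) hs hb hm hfin h1 h2 hC
    (fun i hi => (lintegral_mono fun ω => hZW i hi ω).trans (h3 i hi)) hη
  have hB : P {ω | ENNReal.ofReal y ≤ ENNReal.ofReal K⁻¹ * ∑ i ∈ s, W i ω} ≤
      ENNReal.ofReal (2 * C / (K * b)) := by
    have hWs : Measurable fun ω => ∑ i ∈ s, W i ω := Finset.measurable_fun_sum s hWm
    refine (meas_ge_le_lintegral_div (hWs.const_mul _).aemeasurable
      (ENNReal.ofReal_pos.2 hy0).ne' ENNReal.ofReal_ne_top).trans ?_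
    rw [lintegral_const_mul _ hWs, lintegral_finsetSum _ hWm]
    have hsum : ∑ i ∈ s, ∫⁻ ω, W i ω ∂P ≤ ENNReal.ofReal (s.card * C) := by
      rw [ENNReal.ofReal_mul (by positivity), ENNReal.ofReal_natCast, ← nsmul_eq_mul,
        ← Finset.sum_const]
      exact Finset.sum_le_sum h3
    refine (ENNReal.div_le_div_right (mul_le_mul_right hsum _) _).trans (le_of_eq ?_)
    rw [← ENNReal.ofReal_mul (by positivity), ← ENNReal.ofReal_div_of_pos hy0, hy]
    congr 1
    field_simp
  refine le_trans (measure_mono fun ω hω => ?_) ((measure_union_le _ _).trans (add_le_add hA hB))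
  have h : 2 * ∑ i ∈ s, Z i ω ≤
    ENNReal.ofReal (K * M) + ENNReal.ofReal K⁻¹ * ∑ i ∈ s, W i ω := hω
  by_cases hz : ∑ i ∈ s, Z i ω ≤ ENNReal.ofReal y
  · exact Or.inl hz
  · refine Or.inr ?_
    show ENNReal.ofReal y ≤ ENNReal.ofReal K⁻¹ * ∑ i ∈ s, W i ω
    have hz' := (not_le.1 hz).le
    have h4 : ENNReal.ofReal y + ENNReal.ofReal y ≤
        ENNReal.ofReal y + ENNReal.ofReal K⁻¹ * ∑ i ∈ s, W i ω := by
      rw [← two_mul]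
      refine (mul_le_mul_right hz' 2).trans (h.trans (add_le_add_left ?_ _))
      exact ENNReal.ofReal_le_ofReal (by rw [hy]; linarith)
    exact (ENNReal.add_le_add_iff_left ENNReal.ofReal_ne_top).1 h4

end SecondMoment

namespace IsFractionalBrownianMotion

variable {Ω : Type*} [MeasurableSpace Ω] {P : Measure Ω} [IsProbabilityMeasure P] {H : ℝ}
  {B : ℝ → Ω → ℝ}

lemma ae_ne (hB : IsFractionalBrownianMotion P H B) (hH : 0 < H) (x : ℝ) {t : ℝ} (ht : 0 < t) :
    ∀ᵐ ω ∂P, B t ω ≠ x := by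
  have h := hB.measure_near_le_rpow hH ht x 0
  rw [mul_zero, zero_mul, zero_mul, ENNReal.ofReal_zero, nonpos_iff_eq_zero] at h
  refine measure_mono_null (fun ω hω => ?_) h
  have h' : B t ω = x := not_not.1 hω
  show |B t ω - x| ≤ 0
  simp [h']

/-- On a long sparse sequence of blocks, the normalised occupation times of a small interval
around `x` rarely stay below the bound that a small Hausdorff content would impose. -/
lemma exists_measure_two_mul_sum_normOcc_le (hB : IsFractionalBrownianMotion P H B)
    (hc : ∀ ω, Continuous fun t => B t ω) (hH : H ∈ Ioo (0 : ℝ) 1) {ρ : ℝ} (hρ : 0 ≤ ρ)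
    (hρH : ρ + H < 1) (x M : ℝ) {ε : ℝ} (hε : 0 < ε) :
    ∃ K : ℝ, 0 < K ∧ ∃ k : ℕ → ℕ, Function.Injective k ∧ ∃ N : ℕ, ∀ r : ℝ, 0 < r → r ≤ 1 →
      P {ω | 2 * ∑ i ∈ Finset.range N, normOcc H (fun t => B t ω) x r (k i) ≤
        ENNReal.ofReal (K * M) + ENNReal.ofReal K⁻¹ *
          ∑ i ∈ Finset.range N, normEnergy H ρ (fun t => B t ω) x r (k i)} ≤
        ENNReal.ofReal ε := by
  set b := occMean H
  have hb : 0 < b := occMean_pos hH.2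
  set C := energyBound H ρ
  have hC : 0 ≤ C := energyBound_nonneg hρH
  set K := 4 * C / (b * ε) + 1 with hKdef
  have hK : 0 < K := by positivity
  set η := min 1 (ε / 48) with hηdef
  have hη : 0 < η := lt_min one_pos (by positivity)
  obtain ⟨n₀, hn₀⟩ := hB.exists_le_lintegral_normOcc hc hH x hη (min_le_left _ _)
  obtain ⟨d, hd⟩ := hB.exists_lintegral_normOcc_mul_le hc hH hη
  obtain ⟨N, hN⟩ := exists_nat_gt (max 1 (max (16 * C / (ε * b ^ 2)) (2 * (K * M) / b)))
  simp only [max_lt_iff] at hN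
  obtain ⟨hN1, hN2, hN3⟩ := hN
  have hNpos : 0 < N := by exact_mod_cast one_pos.trans hN1
  set k : ℕ → ℕ := fun i => n₀ + i * (d + 1) with hk
  have hsep : ∀ i j, i < j → k i + d ≤ k j := by
    intro i j hij
    have : (i + 1) * (d + 1) ≤ j * (d + 1) := Nat.mul_le_mul_right _ hij
    simp only [hk]
    linarith
  have hinj : Function.Injective k := by
    intro i j hij
    simpa [hk] using hij
  refine ⟨K, hK, k, hinj, N, fun r hr hr1 => ?_⟩
  have hmain := measure_two_mul_sum_le_le (P := P) (s := Finset.range N) (b := b) (C := C)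
    (η := η) (K := K) (M := M) (Z := fun i ω => normOcc H (fun t => B t ω) x r (k i))
    (W := fun i ω => normEnergy H ρ (fun t => B t ω) x r (k i))
    (Finset.nonempty_range_iff.2 hNpos.ne') hb
    (fun i _ => measurable_normOcc hB.measurable hc H x r (k i))
    (fun i _ ω => normOcc_ne_top _ _ _ _ _)
    (fun i _ => hn₀ _ (Nat.le_add_right _ _) r hr hr1)
    (fun i _ j _ hij => by
      rcases hij.lt_or_gt with h | h
      · exact hd _ _ (hsep i j h) x r hr
      · simp_rw [mul_comm (normOcc H _ x r (k i))]
        exact hd _ _ (hsep j i h) x r hr)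
    hC (fun i _ => measurable_normEnergy hB.measurable hc H ρ x r (k i))
    (fun i _ ω => normOcc_sq_le hρ (hc ω) x r (k i))
    (fun i _ => hB.lintegral_normEnergy_le hc hH hρH x hr (k i)) hη.le hK (by
      rw [div_lt_iff₀ hb] at hN3
      rw [Finset.card_range]
      exact hN3.le)
  refine hmain.trans ?_
  rw [Finset.card_range]
  have hNR : (0 : ℝ) < N := by exact_mod_cast hNpos
  rw [← ENNReal.ofReal_add (by positivity) (by positivity)]
  refine ENNReal.ofReal_le_ofReal ?_
  have e1 : 12 * η ≤ ε / 4 := by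
    have := min_le_right 1 (ε / 48)
    linarith
  have e2 : 4 * (C / (N * b ^ 2)) ≤ ε / 4 := by
    rw [div_lt_iff₀ (by positivity)] at hN2
    rw [← mul_div_assoc, div_le_iff₀ (by positivity)]
    linarith
  have e3 : 2 * C / (K * b) ≤ ε / 2 := by
    have : K * b = 4 * C / ε + b := by
      rw [hKdef]; field_simp
    rw [div_le_iff₀ (by positivity), this]
    have : ε / 2 * (4 * C / ε + b) = 2 * C + ε / 2 * b := by field_simp; ring
    rw [this]
    have : 0 < ε / 2 * b := by positivity
    linarith
  linarith

lemma ae_tsum_nu_eq_top (hB : IsFractionalBrownianMotion P H B)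
    (hc : ∀ ω, Continuous fun t => B t ω) (hH : H ∈ Ioo (0 : ℝ) 1) {ρ : ℝ} (hρ : 0 ≤ ρ)
    (hρH : ρ + H < 1) (x : ℝ) :
    ∀ᵐ ω ∂P, ∑' n, nu ρ n (levelSet B x ω) = ∞ := by
  have hzero : ∀ᵐ ω ∂P, ∀ k : ℕ, 1 ≤ k → B k ω ≠ x := by
    rw [ae_all_iff]
    intro k
    by_cases hk : 1 ≤ k
    · filter_upwards [hB.ae_ne hH.1 x (Nat.cast_pos.2 hk : (0 : ℝ) < k)] with ω hω _ using hω
    · exact Filter.Eventually.of_forall fun ω h => absurd h hk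
  have hM : ∀ M : ℕ, ∀ᵐ ω ∂P, ¬ ∑' n, nu ρ n (levelSet B x ω) ≤ M := by
    intro M
    set E : Set Ω := {ω | (∀ k : ℕ, 1 ≤ k → B k ω ≠ x) ∧ ∑' n, nu ρ n (levelSet B x ω) ≤ M}
      with hE
    suffices hE0 : P E = 0 by
      filter_upwards [hzero, measure_eq_zero_iff_ae_notMem.1 hE0] with ω h1 h2 h3
      exact h2 ⟨h1, h3⟩
    refine le_antisymm (le_of_forall_pos_le_add fun ε hε => ?_) bot_le
    rw [zero_add]
    by_cases hεtop : ε = ∞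
    · simp [hεtop]
    rw [← ENNReal.ofReal_toReal hεtop]
    obtain ⟨K, hK, k, hinj, N, hN⟩ := hB.exists_measure_two_mul_sum_normOcc_le hc hH hρ hρH x
      (M + 1) (ENNReal.toReal_pos hε.ne' hεtop)
    set r : ℕ → ℝ := fun m => 1 / ((m : ℝ) + 1) with hr
    set G : ℕ → Set Ω := fun m => {ω | 2 * ∑ i ∈ Finset.range N,
      normOcc H (fun t => B t ω) x (r m) (k i) ≤ ENNReal.ofReal (K * (M + 1)) +
        ENNReal.ofReal K⁻¹ * ∑ i ∈ Finset.range N,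
          normEnergy H ρ (fun t => B t ω) x (r m) (k i)} with hG
    have hsub : E ⊆ ⋃ m₀, ⋂ m ≥ m₀, G m := by
      rintro ω ⟨hω1, hω2⟩
      have hfin : ∀ n, nu ρ n (levelSet B x ω) ≠ ∞ := fun n =>
        ((ENNReal.le_tsum n).trans hω2 |>.trans_lt (ENNReal.natCast_lt_top M)).ne
      have hNinv : ((N : ℝ≥0∞))⁻¹ ≠ 0 := ENNReal.inv_ne_zero.2 (ENNReal.natCast_ne_top N)
      have hi : ∀ i, ∀ᶠ m in Filter.atTop,
          2 * normOcc H (fun t => B t ω) x (r m) (k i) ≤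
            ENNReal.ofReal K * (nu ρ (k i) (levelSet B x ω) + (N : ℝ≥0∞)⁻¹) +
              ENNReal.ofReal K⁻¹ * normEnergy H ρ (fun t => B t ω) x (r m) (k i) := by
        intro i
        obtain ⟨r₀, hr₀, h⟩ := exists_two_mul_volume_nearSet_le (hc ω) hω1 hρ hK (hfin (k i)) hNinv
        filter_upwards [tendsto_one_div_add_atTop_nhds_zero_nat.eventually_lt_const hr₀] with m hm
        exact h _ hm _ (occScale_pos (by positivity) _).le
      have hall := (Filter.eventually_all_finset (Finset.range N)).2 fun i _ => hi i
      obtain ⟨m₀, hm₀⟩ := Filter.eventually_atTop.1 hall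
      refine mem_iUnion.2 ⟨m₀, mem_iInter₂.2 fun m hm => ?_⟩
      have hsum : ∑ i ∈ Finset.range N, nu ρ (k i) (levelSet B x ω) ≤ M :=
        ((ENNReal.sum_le_tsum _).trans (ENNReal.tsum_comp_le_tsum_of_injective hinj _)).trans hω2
      show 2 * ∑ i ∈ Finset.range N, normOcc H (fun t => B t ω) x (r m) (k i) ≤
        ENNReal.ofReal (K * (M + 1)) + ENNReal.ofReal K⁻¹ *
          ∑ i ∈ Finset.range N, normEnergy H ρ (fun t => B t ω) x (r m) (k i)
      rw [Finset.mul_sum]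
      refine (Finset.sum_le_sum (hm₀ m hm)).trans ?_
      rw [Finset.sum_add_distrib, ← Finset.mul_sum, ← Finset.mul_sum, Finset.sum_add_distrib,
        Finset.sum_const, Finset.card_range, nsmul_eq_mul, ENNReal.ofReal_mul hK.le]
      refine add_le_add_left (mul_le_mul_right ?_ _) _
      rw [ENNReal.ofReal_add (Nat.cast_nonneg M) zero_le_one, ENNReal.ofReal_natCast,
        ENNReal.ofReal_one]
      exact add_le_add hsum (ENNReal.mul_inv_le_one _)
    have hmono : Monotone fun m₀ => ⋂ m ≥ m₀, G m := fun m₀ m₁ h =>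
      biInter_subset_biInter_left fun m hm => h.trans hm
    refine (measure_mono hsub).trans ?_
    rw [hmono.measure_iUnion]
    refine iSup_le fun m₀ => (measure_mono (biInter_subset_of_mem (le_refl m₀))).trans ?_
    refine hN (r m₀) (by positivity) ?_
    rw [hr]
    exact (div_le_one (by positivity)).2 (by linarith [(Nat.cast_nonneg m₀ : (0 : ℝ) ≤ m₀)])
  filter_upwards [ae_all_iff.2 hM] with ω hω
  by_contra hne
  obtain ⟨M, hlt⟩ := ENNReal.exists_nat_gt hne
  exact hω M hlt.le

end IsFractionalBrownianMotion

lemma exists_gaussianReal_tail_le (p : ℕ) :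
    ∃ C : ℝ, 0 ≤ C ∧ ∀ σ y : ℝ, 0 < σ → 0 < y →
      gaussianReal 0 (σ ^ 2).toNNReal {u | y < |u|} ≤ ENNReal.ofReal (C * (σ / y) ^ p) := by
  have hint : Integrable (fun u : ℝ => |u| ^ p) (gaussianReal 0 1) := by
    have h := (memLp_id_gaussianReal' (μ := 0) (v := 1) p (by simp)).integrable_norm_pow'
    simpa using h
  refine ⟨∫ u, |u| ^ p ∂gaussianReal 0 1, integral_nonneg fun u => by positivity,
    fun σ y hσ hy => ?_⟩
  have hmap : gaussianReal 0 (σ ^ 2).toNNReal = (gaussianReal 0 1).map (σ * ·) := by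
    rw [gaussianReal_map_const_mul]
    congr 1
    · simp
    · rw [mul_one]
      exact Real.toNNReal_of_nonneg (sq_nonneg σ)
  have hmeas : MeasurableSet {u : ℝ | y < |u|} := measurableSet_lt (by fun_prop) (by fun_prop)
  rw [hmap, Measure.map_apply (by fun_prop) hmeas, ← ofReal_measureReal]
  refine ENNReal.ofReal_le_ofReal ?_
  have hyσ : 0 < (y / σ) ^ p := by positivity
  have hmk := mul_meas_ge_le_integral_of_nonneg (μ := gaussianReal 0 1)
    (Filter.Eventually.of_forall fun u : ℝ => pow_nonneg (abs_nonneg u) p) hint ((y / σ) ^ p)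
  have hsub : (gaussianReal 0 1).real ((fun u => σ * u) ⁻¹' {u | y < |u|}) ≤
      (gaussianReal 0 1).real {u | (y / σ) ^ p ≤ |u| ^ p} := by
    refine measureReal_mono fun u hu => ?_
    have h : y < |σ * u| := hu
    rw [abs_mul, abs_of_pos hσ] at h
    refine pow_le_pow_left₀ (div_nonneg hy.le hσ.le) (?_ : y / σ ≤ |u|) p
    rw [div_le_iff₀ hσ]
    linarith
  refine hsub.trans ?_
  rw [← mul_le_mul_iff_right₀ hyσ]
  refine hmk.trans (le_of_eq ?_)
  rw [mul_comm, mul_assoc, ← mul_pow, div_mul_div_cancel₀' hσ.ne', div_self hy.ne', one_pow,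
    mul_one]

/-- Dyadic chaining on an interval of length one. -/
lemma abs_sub_le_of_dyadic_increments {f : ℝ → ℝ} (hf : Continuous f) {a l θ : ℝ} (hl : 0 ≤ l)
    (hθ : 0 ≤ θ) (hθ1 : θ < 1)
    (h : ∀ j i : ℕ, i < 2 ^ j → |f (a + (i + 1) / 2 ^ j) - f (a + i / 2 ^ j)| ≤ l * θ ^ j)
    {t : ℝ} (ht : t ∈ Icc a (a + 1)) : |f t - f a| ≤ l * (1 - θ)⁻¹ := by
  have hdy : ∀ j i : ℕ, i ≤ 2 ^ j →
      |f (a + i / 2 ^ j) - f a| ≤ l * ∑ m ∈ Finset.range (j + 1), θ ^ m := by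
    intro j
    induction j with
    | zero =>
      intro i hi
      rw [pow_zero] at hi
      interval_cases i
      · simpa using hl
      · simpa using h 0 0 (by norm_num)
    | succ j ih =>
      intro i hi
      have heven : ∀ m : ℕ, a + ((2 * m : ℕ) : ℝ) / 2 ^ (j + 1) = a + m / 2 ^ j := fun m => by
        push_cast; rw [pow_succ]; field_simp
      rw [Finset.sum_range_succ, mul_add]
      rcases Nat.even_or_odd' i with ⟨m, rfl | rfl⟩
      · rw [heven]
        have := ih m (by rw [pow_succ] at hi; omega)
        have : 0 ≤ l * θ ^ (j + 1) := by positivity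
        linarith
      · have h1 := ih m (by rw [pow_succ] at hi; omega)
        have h2 := h (j + 1) (2 * m) (by omega)
        rw [heven] at h2
        push_cast at h2 ⊢
        have h3 := abs_sub_le (f (a + (2 * m + 1) / 2 ^ (j + 1))) (f (a + m / 2 ^ j)) (f a)
        linarith
  have hdy' : ∀ j i : ℕ, i ≤ 2 ^ j → |f (a + i / 2 ^ j) - f a| ≤ l * (1 - θ)⁻¹ := fun j i hi =>
    by
    refine (hdy j i hi).trans (mul_le_mul_of_nonneg_left ?_ hl)
    rw [← tsum_geometric_of_lt_one hθ hθ1]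
    exact (summable_geometric_of_lt_one hθ hθ1).sum_le_tsum _ fun m _ => by positivity
  have hlim : Filter.Tendsto (fun j : ℕ => a + (⌊(t - a) * 2 ^ j⌋₊ : ℝ) / 2 ^ j)
      Filter.atTop (nhds t) := by
    have h1 := (tendsto_nat_floor_mul_div_atTop (sub_nonneg.2 ht.1)).comp
      (tendsto_pow_atTop_atTop_of_one_lt (one_lt_two : (1 : ℝ) < 2))
    simpa using h1.const_add a
  have hlim2 := ((((hf.tendsto t).comp hlim).sub_const (f a)).abs)
  refine le_of_tendsto hlim2 (Filter.Eventually.of_forall fun j => hdy' j _ ?_)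
  have : (⌊(t - a) * 2 ^ j⌋₊ : ℝ) ≤ 2 ^ j := by
    refine (Nat.floor_le (mul_nonneg (sub_nonneg.2 ht.1) (by positivity))).trans ?_
    refine mul_le_of_le_one_left (by positivity) (by linarith [ht.2])
  exact_mod_cast this

/-- Covering a set by the unit intervals it meets. -/
lemma nu_le_sum_unit_intervals (ρ : ℝ) (n : ℕ) (E : Set ℝ) :
    nu ρ n E ≤ ∑ k ∈ Finset.Ico (2 ^ n) (2 ^ (n + 1)),
      {k : ℕ | (E ∩ Icc (k : ℝ) (k + 1)).Nonempty}.indicator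
        (fun _ => ENNReal.ofReal ((1 / 2 ^ (n + 1)) ^ ρ)) k := by
  classical
  set F := (Finset.Ico (2 ^ n) (2 ^ (n + 1))).filter
    fun k : ℕ => (E ∩ Icc (k : ℝ) (k + 1)).Nonempty with hF
  set e : ℕ ↪ ℕ × ℕ := ⟨fun k => (k, k + 1), fun k l h => (Prod.ext_iff.1 h).1⟩ with he
  have hcov : IsProperCover n E (F.map e) := by
    refine ⟨fun p hp => ?_, fun t ht => ?_⟩
    · obtain ⟨k, hk, rfl⟩ := Finset.mem_map.1 hp
      obtain ⟨h1, h2⟩ := Finset.mem_Ico.1 (Finset.mem_filter.1 hk).1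
      refine ⟨Nat.lt_succ_self k, ?_, ?_⟩
      · show (2 : ℝ) ^ n ≤ (k : ℝ)
        exact_mod_cast h1
      · show ((k + 1 : ℕ) : ℝ) ≤ 2 ^ (n + 1)
        exact_mod_cast h2
    · obtain ⟨htE, ht1, ht2⟩ := ht
      have ht0 : 0 ≤ t := le_trans (by positivity) ht1
      have hfl := Nat.floor_le ht0
      have hfl' := (Nat.lt_floor_add_one t).le
      refine mem_iUnion₂.2 ⟨e ⌊t⌋₊, Finset.mem_map_of_mem e (Finset.mem_filter.2
        ⟨Finset.mem_Ico.2 ⟨Nat.le_floor (by exact_mod_cast ht1), ?_⟩, t, htE, hfl, hfl'⟩), ?_⟩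
      · rw [Nat.floor_lt ht0]
        exact_mod_cast ht2
      · refine ⟨hfl, ?_⟩
        show t ≤ ((⌊t⌋₊ + 1 : ℕ) : ℝ)
        exact_mod_cast hfl'
  refine (iInf₂_le _ hcov).trans (le_of_eq ?_)
  rw [Finset.sum_map, hF, Finset.sum_filter]
  refine Finset.sum_congr rfl fun k _ => ?_
  have hdiff : (((e k).2 : ℝ) - (e k).1) = 1 := by
    show ((k + 1 : ℕ) : ℝ) - k = 1
    push_cast
    ring
  rw [hdiff, indicator]
  rfl

namespace IsFractionalBrownianMotion

variable {Ω : Type*} [MeasurableSpace Ω] {P : Measure Ω} [IsProbabilityMeasure P] {H : ℝ}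
  {B : ℝ → Ω → ℝ}

lemma exists_measure_oscillation_le (hB : IsFractionalBrownianMotion P H B)
    (hc : ∀ ω, Continuous fun t => B t ω) (hH : 0 < H) (q : ℕ) :
    ∃ C S : ℝ, 0 ≤ C ∧ 0 < S ∧ ∀ a l : ℝ, 0 ≤ a → 1 ≤ l →
      P {ω | ∃ t ∈ Icc a (a + 1), l * S < |B t ω - B a ω|} ≤ ENNReal.ofReal (C * (l ^ q)⁻¹) := by
  obtain ⟨r, hr⟩ := exists_nat_gt (4 / H)
  set p := q + r with hp
  obtain ⟨C, hC, htail⟩ := exists_gaussianReal_tail_le p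
  set θ : ℝ := 2 ^ (-(H / 2)) with hθ
  have hθ0 : 0 < θ := by positivity
  have hθ1 : θ < 1 := Real.rpow_lt_one_of_one_lt_of_neg one_lt_two (by linarith)
  have hθr : θ ^ p ≤ 1 / 4 := by
    have h4 : 4 / H < p := hr.trans_le (by rw [hp]; push_cast; linarith [(Nat.cast_nonneg q : (0 : ℝ) ≤ q)])
    rw [div_lt_iff₀ hH] at h4
    rw [hθ, ← Real.rpow_natCast, ← Real.rpow_mul two_pos.le]
    calc (2 : ℝ) ^ (-(H / 2) * p) ≤ 2 ^ (-2 : ℝ) :=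
          Real.rpow_le_rpow_of_exponent_le one_le_two (by linarith)
      _ = 1 / 4 := by rw [Real.rpow_neg two_pos.le]; norm_num
  refine ⟨2 * C, (1 - θ)⁻¹, by positivity, inv_pos.2 (by linarith), fun a l ha hl => ?_⟩
  have hl0 : 0 < l := by linarith
  set E : ℕ → ℕ → Set Ω := fun j i =>
    {ω | l * θ ^ j < |B (a + (i + 1) / 2 ^ j) ω - B (a + i / 2 ^ j) ω|} with hE
  have hEP : ∀ j i, P (E j i) ≤ ENNReal.ofReal (C * (l ^ q)⁻¹ * (1 / 4) ^ j) := by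
    intro j i
    have hs : 0 ≤ a + (i : ℝ) / 2 ^ j := by positivity
    have ht : 0 ≤ a + ((i : ℝ) + 1) / 2 ^ j := by positivity
    have hmap := hB.map_sub_eq hH hs ht
    have habs : |a + (i : ℝ) / 2 ^ j - (a + ((i : ℝ) + 1) / 2 ^ j)| = ((2 : ℝ) ^ j)⁻¹ := by
      rw [show a + (i : ℝ) / 2 ^ j - (a + ((i : ℝ) + 1) / 2 ^ j) = -((2 : ℝ) ^ j)⁻¹ by
        field_simp; ring, abs_neg, abs_of_pos (by positivity)]
    have hθj : (((2 : ℝ) ^ j)⁻¹) ^ H = (θ ^ j) ^ 2 := by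
      rw [← pow_mul, mul_comm j 2, pow_mul, hθ, ← Real.rpow_natCast (_ ^ _) 2,
        ← Real.rpow_mul two_pos.le, ← inv_pow, ← Real.rpow_natCast (_ : ℝ) j,
        ← Real.rpow_natCast (_ : ℝ) j, ← Real.rpow_neg_one, ← Real.rpow_mul two_pos.le,
        ← Real.rpow_mul two_pos.le, ← Real.rpow_mul two_pos.le]
      congr 1
      push_cast
      ring
    rw [habs, rpow_two_mul (by positivity), hθj] at hmap
    have hmeas : MeasurableSet {u : ℝ | l * θ ^ j < |u|} :=
      measurableSet_lt (by fun_prop) (by fun_prop)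
    have hpre : P (E j i) = P.map (fun ω => B (a + (i + 1) / 2 ^ j) ω - B (a + i / 2 ^ j) ω)
        {u | l * θ ^ j < |u|} :=
      (Measure.map_apply ((hB.measurable _).sub (hB.measurable _)) hmeas).symm
    rw [hpre, hmap]
    refine (htail _ _ (by positivity) (by positivity)).trans (ENNReal.ofReal_le_ofReal ?_)
    rw [mul_assoc]
    refine mul_le_mul_of_nonneg_left ?_ hC
    have : (θ ^ j) ^ 2 / (l * θ ^ j) = l⁻¹ * θ ^ j := by field_simp
    rw [this, mul_pow, ← pow_mul, mul_comm j p, pow_mul, inv_pow]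
    refine mul_le_mul ?_ (pow_le_pow_left₀ (by positivity) hθr j) (by positivity) (by positivity)
    exact inv_anti₀ (by positivity) (pow_le_pow_right₀ hl (Nat.le_add_right q r))
  have hsub : {ω | ∃ t ∈ Icc a (a + 1), l * (1 - θ)⁻¹ < |B t ω - B a ω|} ⊆
      ⋃ j : ℕ, ⋃ i ∈ Finset.range (2 ^ j), E j i := by
    rintro ω ⟨t, ht, hlt⟩
    by_contra hcon
    refine absurd hlt (not_lt.2 (abs_sub_le_of_dyadic_increments (hc ω) hl0.le hθ0.le hθ1 ?_ ht))
    intro j i hi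
    by_contra hij
    exact hcon (mem_iUnion.2 ⟨j, mem_biUnion (Finset.mem_range.2 hi) (not_le.1 hij)⟩)
  have hlevel : ∀ j, P (⋃ i ∈ Finset.range (2 ^ j), E j i) ≤
      ENNReal.ofReal (C * (l ^ q)⁻¹ * (1 / 2) ^ j) := by
    intro j
    refine (measure_biUnion_finset_le _ _).trans ((Finset.sum_le_sum fun i _ => hEP j i).trans ?_)
    rw [Finset.sum_const, Finset.card_range, nsmul_eq_mul, ← ENNReal.ofReal_natCast,
      ← ENNReal.ofReal_mul (by positivity)]
    refine ENNReal.ofReal_le_ofReal (le_of_eq ?_)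
    push_cast
    rw [mul_left_comm, ← mul_pow]
    norm_num
  refine (measure_mono hsub).trans ((measure_iUnion_le _).trans
    ((ENNReal.tsum_le_tsum hlevel).trans (le_of_eq ?_)))
  rw [← ENNReal.ofReal_tsum_of_nonneg (fun j => by positivity)
    (summable_geometric_two.mul_left _), tsum_mul_left, tsum_geometric_two]
  congr 1
  ring

/-- The probability that a fractional Brownian motion visits `x` during a unit time interval. -/
lemma exists_measure_hit_le (hB : IsFractionalBrownianMotion P H B)
    (hc : ∀ ω, Continuous fun t => B t ω) (hH : 0 < H) (x : ℝ) {δ : ℝ} (hδ : 0 < δ) :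
    ∃ C : ℝ, 0 ≤ C ∧ ∀ k : ℕ, 1 ≤ k →
      P {ω | (levelSet B x ω ∩ Icc (k : ℝ) (k + 1)).Nonempty} ≤
        ENNReal.ofReal (C * (k : ℝ) ^ (δ - H)) := by
  obtain ⟨q, hq⟩ := exists_nat_gt (H / δ)
  rw [div_lt_iff₀ hδ] at hq
  obtain ⟨C, S, hC, hS, hosc⟩ := hB.exists_measure_oscillation_le hc hH q
  refine ⟨2 * S * (√(2 * Real.pi))⁻¹ + C, by positivity, fun k hk => ?_⟩
  have hk1 : (1 : ℝ) ≤ k := by exact_mod_cast hk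
  have hk0 : (0 : ℝ) < k := by linarith
  set l : ℝ := (k : ℝ) ^ δ with hl
  have hl1 : 1 ≤ l := Real.one_le_rpow hk1 hδ.le
  have h1 := hB.measure_near_le_rpow hH hk0 x (l * S)
  have h2 := hosc k l hk0.le hl1
  refine le_trans (measure_mono (t := {ω | |B k ω - x| ≤ l * S} ∪
    {ω | ∃ t ∈ Icc (k : ℝ) (k + 1), l * S < |B t ω - B k ω|}) ?_)
    ((measure_union_le _ _).trans ((add_le_add h1 h2).trans ?_))
  · rintro ω ⟨t, ⟨-, htx⟩, ht⟩
    by_cases h : |B k ω - x| ≤ l * S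
    · exact Or.inl h
    · refine Or.inr ⟨t, ht, ?_⟩
      rw [htx, abs_sub_comm]
      exact not_le.1 h
  · rw [← ENNReal.ofReal_add (by positivity) (by positivity)]
    refine ENNReal.ofReal_le_ofReal ?_
    rw [add_mul]
    refine add_le_add (le_of_eq ?_) (mul_le_mul_of_nonneg_left ?_ hC)
    · rw [sub_eq_add_neg, Real.rpow_add hk0]; ring
    · rw [hl, ← Real.rpow_natCast, ← Real.rpow_mul hk0.le, ← Real.rpow_neg hk0.le]
      exact Real.rpow_le_rpow_of_exponent_le hk1 (by nlinarith)

lemma ae_tsum_nu_ne_top (hB : IsFractionalBrownianMotion P H B)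
    (hc : ∀ ω, Continuous fun t => B t ω) (hH : H ∈ Ioo (0 : ℝ) 1) {ρ : ℝ} (hρH : 1 < ρ + H)
    (x : ℝ) : ∀ᵐ ω ∂P, ∑' n, nu ρ n (levelSet B x ω) ≠ ∞ := by
  obtain ⟨δ, hδ0, hδ⟩ : ∃ δ : ℝ, 0 < δ ∧ δ < min H (ρ + H - 1) :=
    exists_between (lt_min hH.1 (by linarith))
  obtain ⟨hδH, hδρ⟩ := lt_min_iff.1 hδ
  obtain ⟨C, hC, hhit⟩ := hB.exists_measure_hit_le hc hH.1 x hδ0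
  set A : ℕ → Set Ω := fun k =>
    toMeasurable P {ω | (levelSet B x ω ∩ Icc (k : ℝ) (k + 1)).Nonempty} with hA
  have hAm : ∀ k, MeasurableSet (A k) := fun k => measurableSet_toMeasurable _ _
  set F : ℕ → Ω → ℝ≥0∞ := fun n ω => ∑ k ∈ Finset.Ico (2 ^ n) (2 ^ (n + 1)),
    (A k).indicator (fun _ => ENNReal.ofReal ((1 / 2 ^ (n + 1)) ^ ρ)) ω with hF
  have hFm : ∀ n, Measurable (F n) := fun n =>
    Finset.measurable_fun_sum _ fun k _ => measurable_const.indicator (hAm k)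
  have hle : ∀ n ω, nu ρ n (levelSet B x ω) ≤ F n ω := by
    intro n ω
    refine (nu_le_sum_unit_intervals ρ n _).trans (Finset.sum_le_sum fun k _ => ?_)
    by_cases h : (levelSet B x ω ∩ Icc (k : ℝ) (k + 1)).Nonempty
    · rw [indicator_of_mem (show ω ∈ A k from subset_toMeasurable _ _ h)]
      exact indicator_le_self _ _ _
    · rw [indicator_of_notMem (show k ∉ _ from h)]
      exact bot_le
  set β : ℝ := 2 ^ (1 + δ - H - ρ) with hβ
  have hβ1 : β < 1 := Real.rpow_lt_one_of_one_lt_of_neg one_lt_two (by linarith)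
  have hβ0 : 0 < β := by positivity
  have hint : ∀ n, ∫⁻ ω, F n ω ∂P ≤ ENNReal.ofReal (C * 2 ^ (-ρ) * β ^ n) := by
    intro n
    rw [hF, lintegral_finsetSum _ fun k _ => measurable_const.indicator (hAm k)]
    have hterm : ∀ k ∈ Finset.Ico (2 ^ n) (2 ^ (n + 1)),
        ∫⁻ ω, (A k).indicator (fun _ => ENNReal.ofReal ((1 / 2 ^ (n + 1)) ^ ρ)) ω ∂P ≤
          ENNReal.ofReal ((1 / 2 ^ (n + 1)) ^ ρ * (C * ((2 : ℝ) ^ n) ^ (δ - H))) := by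
      intro k hk
      have hk' := (Finset.mem_Ico.1 hk).1
      rw [lintegral_indicator_const (hAm k), measure_toMeasurable,
        ENNReal.ofReal_mul (by positivity)]
      refine mul_le_mul_right ((hhit k (Nat.one_le_two_pow.trans hk')).trans
        (ENNReal.ofReal_le_ofReal (mul_le_mul_of_nonneg_left ?_ hC))) _
      exact Real.rpow_le_rpow_of_nonpos (by positivity) (by exact_mod_cast hk') (by linarith)
    refine (Finset.sum_le_sum hterm).trans (le_of_eq ?_)
    rw [Finset.sum_const, Nat.card_Ico, nsmul_eq_mul, ← ENNReal.ofReal_natCast,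
      ← ENNReal.ofReal_mul (by positivity), show 2 ^ (n + 1) - 2 ^ n = 2 ^ n by rw [pow_succ]; omega]
    congr 1
    push_cast
    set a : ℝ := 2 ^ n with ha
    have ha0 : 0 < a := by positivity
    have e1 : ((1 : ℝ) / 2 ^ (n + 1)) ^ ρ = 2 ^ (-ρ) * a ^ (-ρ) := by
      rw [pow_succ, ← ha, one_div, Real.inv_rpow (by positivity), ← Real.rpow_neg (by positivity),
        Real.mul_rpow ha0.le two_pos.le, mul_comm]
    have e2 : β ^ n = a ^ (1 + δ - H - ρ) := by
      rw [hβ, ha, ← Real.rpow_natCast (_ ^ _) n, ← Real.rpow_natCast 2 n,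
        ← Real.rpow_mul two_pos.le, ← Real.rpow_mul two_pos.le, mul_comm]
    have e3 : a ^ (1 + δ - H - ρ) = a * a ^ (δ - H) * a ^ (-ρ) := by
      rw [show 1 + δ - H - ρ = 1 + (δ - H) + -ρ by ring, Real.rpow_add ha0, Real.rpow_add ha0,
        Real.rpow_one]
    rw [e1, e2, e3]
    ring
  have htot : ∫⁻ ω, ∑' n, F n ω ∂P ≠ ∞ := by
    rw [lintegral_tsum fun n => (hFm n).aemeasurable]
    refine ((ENNReal.tsum_le_tsum hint).trans_lt ?_).ne
    rw [← ENNReal.ofReal_tsum_of_nonneg (fun n => by positivity)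
      ((summable_geometric_of_lt_one hβ0.le hβ1).mul_left _)]
    exact ENNReal.ofReal_lt_top
  filter_upwards [ae_lt_top (Measurable.tsum hFm) htot] with ω hω
  exact ((ENNReal.tsum_le_tsum fun n => hle n ω).trans_lt hω).ne

end IsFractionalBrownianMotion

lemma macroDim_eq_of_forall {E : Set ℝ} {d : ℝ} (hd : 0 < d)
    (hlow : ∀ ρ, 0 ≤ ρ → ρ < d → ∑' n, nu ρ n E = ∞)
    (hupp : ∀ ρ, d < ρ → ∑' n, nu ρ n E ≠ ∞) : macroDim E = d := by
  refine csInf_eq_of_forall_ge_of_forall_gt_exists_lt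
    ⟨d + 1, by linarith, hupp _ (by linarith)⟩ (fun ρ hρ => ?_) (fun y hy => ?_)
  · obtain ⟨h0, hne⟩ := hρ
    by_contra hlt
    exact hne (hlow ρ h0.le (not_le.1 hlt))
  · obtain ⟨z, hz1, hz2⟩ := exists_between hy
    exact ⟨z, ⟨hd.trans hz1, hupp z hz1⟩, hz2⟩

namespace IsFractionalBrownianMotion

variable {Ω : Type*} [MeasurableSpace Ω] {P : Measure Ω} {H : ℝ} {B : ℝ → Ω → ℝ}

lemma comp_max_zero (hB : IsFractionalBrownianMotion P H B) :
    IsFractionalBrownianMotion P H fun t => B (max t 0) where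
  measurable t := hB.measurable _
  continuous ω := (hB.continuous ω).comp (by fun_prop) fun _ _ => mem_Ici.2 (le_max_right _ _)
  gaussian m t c ht := by
    simpa only [max_eq_left (ht _)] using hB.gaussian m t c ht
  covariance s t hs ht := by
    simpa only [max_eq_left hs, max_eq_left ht] using hB.covariance s t hs ht

lemma continuous_comp_max_zero (hB : IsFractionalBrownianMotion P H B) (ω : Ω) :
    Continuous fun t => B (max t 0) ω :=
  (hB.continuous ω).comp_continuous (by fun_prop) fun _ => mem_Ici.2 (le_max_right _ _)

end IsFractionalBrownianMotion

lemma levelSet_comp_max_zero {Ω : Type*} (B : ℝ → Ω → ℝ) (x : ℝ) (ω : Ω) :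
    levelSet (fun t => B (max t 0)) x ω = levelSet B x ω := by
  ext t
  refine and_congr_right fun ht => ?_
  show B (max t 0) ω = x ↔ _
  rw [max_eq_left ht]

/-- Theorem 1 of the paper.  If `B` is a fractional Brownian motion of Hurst
index `H ∈ (0,1)` and `x ∈ ℝ` is fixed, then almost surely the macroscopic Hausdorff dimension
of the level set `L_x = {t ≥ 0 : B_t = x}` equals `1 - H`. -/
theorem macroDim_levelSet_fixed {Ω : Type*} [MeasurableSpace Ω]
    (P : Measure Ω) [IsProbabilityMeasure P] (H : ℝ) (hH : H ∈ Set.Ioo (0 : ℝ) 1)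
    (B : ℝ → Ω → ℝ) (hB : IsFractionalBrownianMotion P H B) (x : ℝ) :
    P {ω | macroDim (levelSet B x ω) = 1 - H} = 1 := by
  have hd : 0 < 1 - H := sub_pos.2 hH.2
  obtain ⟨u, -, hu, hulim⟩ := exists_seq_strictMono_tendsto' hd
  obtain ⟨v, -, hv, hvlim⟩ := exists_seq_strictAnti_tendsto' (lt_add_one (1 - H))
  have hlow := ae_all_iff.2 fun m => hB.comp_max_zero.ae_tsum_nu_eq_top
    hB.continuous_comp_max_zero hH (hu m).1.le (by linarith [(hu m).2]) x
  have hupp := ae_all_iff.2 fun m => hB.comp_max_zero.ae_tsum_nu_ne_top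
    hB.continuous_comp_max_zero hH (ρ := v m) (by linarith [(hv m).1]) x
  simp only [levelSet_comp_max_zero] at hlow hupp
  have hae : ∀ᵐ ω ∂P, macroDim (levelSet B x ω) = 1 - H := by
    filter_upwards [hlow, hupp] with ω h1 h2
    refine macroDim_eq_of_forall hd (fun ρ _ hρ => ?_) fun ρ hρ => ?_
    · obtain ⟨m, hm⟩ := (hulim.eventually_const_lt hρ).exists
      exact top_le_iff.1 ((h1 m).ge.trans (ENNReal.tsum_le_tsum fun n => nu_anti hm.le n _))
    · obtain ⟨m, hm⟩ := (hvlim.eventually_lt_const hρ).exists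
      exact ((ENNReal.tsum_le_tsum fun n => nu_anti hm.le n _).trans_lt (h2 m).lt_top).ne
  rw [measure_eq_measure_of_null_sdiff (subset_univ _) (by rwa [← compl_eq_univ_sdiff]),
    measure_univ]
end
end

section
/- Let 0 < α < 1 and let A_α ⊆ ℝ₊ be the set such that for every n ≥ 1, A_α ∩ S_n = { 2^{n−1} + k·2^{n−1}/2^{nα} : k ∈ {0, 1, …, ⌊2^{nα}⌋ − 1} } (equally spaced points spread over the block S_n). Then Dim_H A_α = α. -/
open MeasureTheory ProbabilityTheory Set
open scoped ENNReal NNReal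

noncomputable section

/-- The set `A_α` of points equally spread over each dyadic block. -/
def spreadSet (α : ℝ) : Set ℝ :=
  {x : ℝ | ∃ n : ℕ, 1 ≤ n ∧ ∃ k : ℕ, k < Nat.floor ((2 : ℝ) ^ ((n : ℝ) * α)) ∧
        x = (2 : ℝ) ^ n / 2 + (k : ℝ) * ((2 : ℝ) ^ n / 2) / (2 : ℝ) ^ ((n : ℝ) * α)}

/-- The `k`-th point of `A_α` in the block `[2^n, 2^(n+1))`. -/
def spreadPoint (α : ℝ) (n k : ℕ) : ℝ :=
  (2 : ℝ) ^ n + (k : ℝ) * (2 : ℝ) ^ n / (2 : ℝ) ^ (((n + 1 : ℕ) : ℝ) * α)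

lemma spreadPoint_mem_Sblock {α : ℝ} {n k : ℕ}
    (hk : k < Nat.floor ((2 : ℝ) ^ (((n + 1 : ℕ) : ℝ) * α))) :
    spreadPoint α n k ∈ Sblock n := by
  have hg : (0 : ℝ) < (2 : ℝ) ^ (((n + 1 : ℕ) : ℝ) * α) := by positivity
  have hk' : (k : ℝ) < (2 : ℝ) ^ (((n + 1 : ℕ) : ℝ) * α) :=
    (Nat.cast_lt.2 hk).trans_le (Nat.floor_le hg.le)
  have h2n : (0 : ℝ) < 2 ^ n := by positivity
  refine ⟨le_add_of_nonneg_right (by positivity), ?_⟩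
  have : (k : ℝ) * 2 ^ n / (2 : ℝ) ^ (((n + 1 : ℕ) : ℝ) * α) < 2 ^ n := by
    rw [div_lt_iff₀ hg, mul_comm]
    gcongr
  rw [spreadPoint, pow_succ]
  linarith

lemma Sblock_index_unique {m n : ℕ} {x : ℝ} (hm : x ∈ Sblock m) (hn : x ∈ Sblock n) : m = n := by
  have h (a b : ℕ) (ha : x ∈ Sblock a) (hb : x ∈ Sblock b) : a ≤ b := by
    have := (pow_lt_pow_iff_right₀ (one_lt_two : (1 : ℝ) < 2)).1 (ha.1.trans_lt hb.2)
    omega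
  exact le_antisymm (h m n hm hn) (h n m hn hm)

lemma mem_spreadSet_inter_Sblock {α x : ℝ} {n : ℕ} :
    x ∈ spreadSet α ∩ Sblock n ↔
      ∃ k < Nat.floor ((2 : ℝ) ^ (((n + 1 : ℕ) : ℝ) * α)), x = spreadPoint α n k := by
  constructor
  · rintro ⟨⟨N, hN, k, hk, hx⟩, hxn⟩
    obtain ⟨m, rfl⟩ : ∃ m, N = m + 1 := ⟨N - 1, by omega⟩
    have hx' : x = spreadPoint α m k := by
      rw [hx, spreadPoint, pow_succ, mul_div_cancel_right₀ _ two_ne_zero]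
    obtain rfl := Sblock_index_unique (hx' ▸ spreadPoint_mem_Sblock hk) hxn
    exact ⟨k, hk, hx'⟩
  · rintro ⟨k, hk, rfl⟩
    refine ⟨⟨n + 1, by omega, k, hk, ?_⟩, spreadPoint_mem_Sblock hk⟩
    rw [spreadPoint, pow_succ, mul_div_cancel_right₀ _ two_ne_zero]

lemma two_pow_rpow (n : ℕ) (ρ : ℝ) : ((2 : ℝ) ^ n) ^ ρ = (2 : ℝ) ^ ((n : ℝ) * ρ) := by
  rw [Real.rpow_natCast_mul zero_le_two]

/-- Covering each point by a unit interval. -/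
lemma nu_spreadSet_le (α ρ : ℝ) (n : ℕ) :
    nu ρ n (spreadSet α) ≤ ENNReal.ofReal (((2 : ℝ) ^ (α - ρ)) ^ (n + 1)) := by
  classical
  set g : ℝ := (2 : ℝ) ^ (((n + 1 : ℕ) : ℝ) * α) with hg
  have hg0 : 0 < g := by positivity
  let u : ℕ → ℕ × ℕ := fun k ↦ (⌊spreadPoint α n k⌋₊, ⌊spreadPoint α n k⌋₊ + 1)
  let c : Finset (ℕ × ℕ) := (Finset.range ⌊g⌋₊).image u
  have hc : IsProperCover n (spreadSet α) c := by
    constructor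
    · intro p hp
      obtain ⟨k, hk, rfl⟩ := Finset.mem_image.1 hp
      have hx := spreadPoint_mem_Sblock (Finset.mem_range.1 hk)
      have hx0 : 0 ≤ spreadPoint α n k := (by positivity : (0 : ℝ) ≤ 2 ^ n).trans hx.1
      refine ⟨Nat.lt_succ_self _, ?_, ?_⟩
      · have : 2 ^ n ≤ ⌊spreadPoint α n k⌋₊ := Nat.le_floor (by exact_mod_cast hx.1)
        exact_mod_cast this
      · have : ⌊spreadPoint α n k⌋₊ < 2 ^ (n + 1) :=
          (Nat.floor_lt hx0).2 (by exact_mod_cast hx.2)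
        exact_mod_cast this
    · intro x hx
      obtain ⟨k, hk, rfl⟩ := mem_spreadSet_inter_Sblock.1 hx
      have hx0 : 0 ≤ spreadPoint α n k := (by positivity : (0 : ℝ) ≤ 2 ^ n).trans hx.2.1
      refine mem_iUnion₂.2 ⟨u k, Finset.mem_image_of_mem u (Finset.mem_range.2 hk), ?_, ?_⟩
      · exact Nat.floor_le hx0
      · simpa [u] using (Nat.lt_floor_add_one (spreadPoint α n k)).le
  refine (iInf₂_le c hc).trans ?_
  have hterm : ∀ p ∈ c, ENNReal.ofReal ((((p.2 : ℝ) - (p.1 : ℝ)) / 2 ^ (n + 1)) ^ ρ) =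
      ENNReal.ofReal ((1 / 2 ^ (n + 1)) ^ ρ) := by
    intro p hp
    obtain ⟨k, -, rfl⟩ := Finset.mem_image.1 hp
    simp [u]
  have hcard : (c.card : ℝ) ≤ g :=
    (Nat.cast_le.2 (Finset.card_image_le.trans_eq (Finset.card_range _))).trans
      (Nat.floor_le hg0.le)
  rw [Finset.sum_congr rfl hterm, Finset.sum_const, ← ENNReal.ofReal_nsmul, nsmul_eq_mul]
  refine ENNReal.ofReal_le_ofReal ((mul_le_mul_of_nonneg_right hcard (by positivity)).trans_eq ?_)
  rw [Real.div_rpow zero_le_one (by positivity), Real.one_rpow, two_pow_rpow, hg,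
    ← Real.rpow_mul_natCast zero_le_two, mul_one_div, ← Real.rpow_sub two_pos]
  congr 1
  ring

lemma card_le_of_sub_le {s : Finset ℕ} {D : ℝ} (hD : 0 ≤ D)
    (h : ∀ i ∈ s, ∀ j ∈ s, (j : ℝ) - i ≤ D) : (s.card : ℝ) ≤ D + 1 := by
  rcases s.eq_empty_or_nonempty with rfl | hs
  · simpa using by linarith
  have hsub : s ⊆ Finset.Icc (s.min' hs) (s.max' hs) := fun i hi ↦
    Finset.mem_Icc.2 ⟨s.min'_le i hi, s.le_max' i hi⟩
  have hle := Finset.card_le_card hsub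
  rw [Nat.card_Icc] at hle
  have hmm : s.min' hs ≤ s.max' hs := s.min'_le _ (s.max'_mem hs)
  have h1 : s.card + s.min' hs ≤ s.max' hs + 1 := by omega
  have h2 : (s.card : ℝ) + s.min' hs ≤ s.max' hs + 1 := by exact_mod_cast h1
  linarith [h _ (s.min'_mem hs) _ (s.max'_mem hs)]

/-- An interval of length at least one inside a block contains few points of `A_α`. -/
lemma card_spreadPoint_mem_Icc_le {α ρ : ℝ} (hρ : 0 ≤ ρ) (hρα : ρ ≤ α) (hα1 : α ≤ 1) {n a b : ℕ}
    (hab : a < b) (ha : (2 : ℝ) ^ n ≤ a) (hb : (b : ℝ) ≤ 2 ^ (n + 1)) {s : Finset ℕ}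
    (hs : ∀ k ∈ s, spreadPoint α n k ∈ Set.Icc (a : ℝ) b) :
    (s.card : ℝ) ≤
      3 * (2 : ℝ) ^ (((n + 1 : ℕ) : ℝ) * α) * (((b : ℝ) - a) / 2 ^ (n + 1)) ^ ρ := by
  set g : ℝ := (2 : ℝ) ^ (((n + 1 : ℕ) : ℝ) * α) with hg
  have hg0 : 0 < g := by positivity
  have h2n : (0 : ℝ) < 2 ^ n := by positivity
  have hL : (1 : ℝ) ≤ b - a := by
    have : (a : ℝ) + 1 ≤ b := by exact_mod_cast hab
    linarith
  set t : ℝ := ((b : ℝ) - a) / 2 ^ (n + 1) with ht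
  have ht0 : 0 < t := by positivity
  have ht1 : t ≤ 1 := (div_le_one (by positivity)).2 (by linarith)
  have hcard : (s.card : ℝ) ≤ 2 * g * t + 1 := by
    refine card_le_of_sub_le (by positivity) fun i hi j hj ↦ ?_
    have hi' := (hs i hi).1
    have hj' := (hs j hj).2
    rw [spreadPoint, ← hg] at hi' hj'
    have hdiff : ((j : ℝ) - i) * (2 ^ n / g) ≤ b - a := by
      calc ((j : ℝ) - i) * (2 ^ n / g) = j * 2 ^ n / g - i * 2 ^ n / g := by ring
        _ ≤ b - a := by linarith
    rw [← le_div_iff₀ (by positivity)] at hdiff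
    refine hdiff.trans_eq ?_
    rw [ht, pow_succ]
    field_simp
  have htρ : t ≤ t ^ ρ := Real.self_le_rpow_of_le_one ht0.le ht1 (hρα.trans hα1)
  have hone : 1 ≤ g * t ^ ρ := by
    have hLρ : 1 ≤ ((b : ℝ) - a) ^ ρ := Real.one_le_rpow hL hρ
    have hgρ : (2 : ℝ) ^ (((n + 1 : ℕ) : ℝ) * ρ) ≤ g :=
      Real.rpow_le_rpow_of_exponent_le one_le_two (by gcongr)
    rw [ht, Real.div_rpow (by linarith) (by positivity), two_pow_rpow, mul_div_assoc',
      le_div_iff₀ (by positivity)]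
    nlinarith
  nlinarith [mul_le_mul_of_nonneg_left htρ hg0.le]

lemma le_nu_spreadSet {α ρ : ℝ} (hρ : 0 ≤ ρ) (hρα : ρ ≤ α) (hα1 : α ≤ 1) (n : ℕ) :
    ENNReal.ofReal (1 / 6) ≤ nu ρ n (spreadSet α) := by
  classical
  refine le_iInf₂ fun c hc ↦ ?_
  have hnn : ∀ p ∈ c, 0 ≤ (((p.2 : ℝ) - (p.1 : ℝ)) / 2 ^ (n + 1)) ^ ρ := fun p hp ↦ by
    have : (p.1 : ℝ) < p.2 := by exact_mod_cast (hc.1 p hp).1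
    exact Real.rpow_nonneg (div_nonneg (by linarith) (by positivity)) _
  rw [← ENNReal.ofReal_sum_of_nonneg hnn]
  refine ENNReal.ofReal_le_ofReal ?_
  set g : ℝ := (2 : ℝ) ^ (((n + 1 : ℕ) : ℝ) * α) with hg
  have hg1 : 1 ≤ g := Real.one_le_rpow one_le_two (mul_nonneg (by positivity) (hρ.trans hρα))
  let s : ℕ × ℕ → Finset ℕ := fun p ↦
    (Finset.range ⌊g⌋₊).filter fun k ↦ spreadPoint α n k ∈ Set.Icc (p.1 : ℝ) p.2
  have hsub : Finset.range ⌊g⌋₊ ⊆ c.biUnion s := by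
    intro k hk
    obtain ⟨p, hp, hkp⟩ := mem_iUnion₂.1
      (hc.2 (mem_spreadSet_inter_Sblock.2 ⟨k, Finset.mem_range.1 hk, rfl⟩))
    exact Finset.mem_biUnion.2 ⟨p, hp, Finset.mem_filter.2 ⟨hk, hkp⟩⟩
  have hcount : (⌊g⌋₊ : ℝ) ≤ ∑ p ∈ c, ((s p).card : ℝ) := by
    have := (Finset.card_le_card hsub).trans Finset.card_biUnion_le
    rw [Finset.card_range] at this
    exact_mod_cast this
  have hbound : ∑ p ∈ c, ((s p).card : ℝ) ≤
      3 * g * ∑ p ∈ c, (((p.2 : ℝ) - (p.1 : ℝ)) / 2 ^ (n + 1)) ^ ρ := by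
    rw [Finset.mul_sum]
    refine Finset.sum_le_sum fun p hp ↦ ?_
    obtain ⟨h1, h2, h3⟩ := hc.1 p hp
    exact card_spreadPoint_mem_Icc_le hρ hρα hα1 h1 h2 h3 fun k hk ↦ (Finset.mem_filter.1 hk).2
  have hfl : g / 2 ≤ ⌊g⌋₊ := by
    have h1 : (1 : ℝ) ≤ ⌊g⌋₊ := by exact_mod_cast (Nat.one_le_floor_iff g).2 hg1
    linarith [Nat.lt_floor_add_one g]
  have hfinal := hfl.trans (hcount.trans hbound)
  by_contra! hlt
  nlinarith

lemma tsum_nu_spreadSet_ne_top {α ρ : ℝ} (h : α < ρ) : ∑' n, nu ρ n (spreadSet α) ≠ ∞ := by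
  have hr : (2 : ℝ) ^ (α - ρ) < 1 := Real.rpow_lt_one_of_one_lt_of_neg one_lt_two (by linarith)
  have hsum : Summable fun n : ℕ ↦ ((2 : ℝ) ^ (α - ρ)) ^ (n + 1) :=
    (summable_nat_add_iff 1).2 (summable_geometric_of_lt_one (by positivity) hr)
  exact ne_top_of_le_ne_top hsum.tsum_ofReal_ne_top
    (ENNReal.tsum_le_tsum (nu_spreadSet_le α ρ))

lemma tsum_nu_spreadSet_eq_top {α ρ : ℝ} (hρ : 0 ≤ ρ) (hρα : ρ ≤ α) (hα1 : α ≤ 1) :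
    ∑' n, nu ρ n (spreadSet α) = ∞ :=
  top_unique ((ENNReal.tsum_const_eq_top_of_ne_zero (α := ℕ)
    (by simp : ENNReal.ofReal (1 / 6) ≠ 0)).symm.trans_le
      (ENNReal.tsum_le_tsum (le_nu_spreadSet hρ hρα hα1)))

/-- For `0 < α < 1`, the set `A_α` with
`A_α ∩ S_n = {2^{n-1} + k · 2^{n-1}/2^{nα} : 0 ≤ k ≤ ⌊2^{nα}⌋ - 1}` for every `n ≥ 1`
(points equally spread over each block) has macroscopic Hausdorff dimension `α`. -/
theorem macroDim_spread_set (α : ℝ) (hα : 0 < α) (hα1 : α < 1) :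
    macroDim {x : ℝ | ∃ n : ℕ, 1 ≤ n ∧ ∃ k : ℕ, k < Nat.floor ((2 : ℝ) ^ ((n : ℝ) * α)) ∧
        x = (2 : ℝ) ^ n / 2 + (k : ℝ) * ((2 : ℝ) ^ n / 2) / (2 : ℝ) ^ ((n : ℝ) * α)} = α := by
  change sInf {ρ : ℝ | 0 < ρ ∧ (∑' n : ℕ, nu ρ n (spreadSet α)) ≠ ∞} = α
  have hmem : ∀ ρ, α < ρ → ρ ∈ {ρ : ℝ | 0 < ρ ∧ (∑' n : ℕ, nu ρ n (spreadSet α)) ≠ ∞} :=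
    fun ρ h ↦ ⟨hα.trans h, tsum_nu_spreadSet_ne_top h⟩
  refine csInf_eq_of_forall_ge_of_forall_gt_exists_lt ⟨α + 1, hmem _ (by linarith)⟩ ?_ ?_
  · rintro ρ ⟨hρ, hfin⟩
    by_contra! h
    exact hfin (tsum_nu_spreadSet_eq_top hρ.le h.le hα1.le)
  · intro w hw
    obtain ⟨ρ, h1, h2⟩ := exists_between hw
    exact ⟨ρ, hmem ρ h1, h2⟩
end
end
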